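/- arXiv:1401.7582 — 6 statements merged into one kernel-verified Lean document; each statement's English description precedes it below -/
import Mathlib

section
/- Let N ≥ 2 and let (T^(n))_{n≥1} be a sequence of N×N row-stochastic matrices with all entries positive satisfying the quasi-stationary condition Σ_{n=1}^∞ |T^(n)_{x_n,x_{n+1}} / T^(n+1)_{x_n,x_{n+1}} − 1| < ∞ for every x₁x₂… ∈ K_N. Let T^(∞) be the entrywise limit of the sequence (T^(n)) (which exists, is row-stochastic, and has positive entries), and let v = (v_0,…,v_{N−1}) be the Perron–Frobenius positive probability left eigenvector of T^(∞), i.e. vT^(∞) = v, v_i > 0 for all i ∈ Z_N, and Σ_i v_i = 1. Let Q be the N×N matrix all of whose rows are equal to v. Then for every p ≥ 1, the matrix products T^(p+1) T^(p+2) ⋯ T^(n) converge entrywise to Q as n → ∞. -/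
open Filter Finset

/-- A positive sequence whose consecutive ratios are summably close to `1` is bounded away
from zero. -/
theorem exists_pos_le_of_summable_abs_div_sub_one {t : ℕ → ℝ} (ht : ∀ n, 0 < t n)
    (hs : Summable fun n => |t n / t (n + 1) - 1|) : ∃ c, 0 < c ∧ ∀ n, c ≤ t n := by
  have key : ∀ n, t 0 ≤ t n * Real.exp (∑ k ∈ range n, |t k / t (k + 1) - 1|) := by
    intro n
    induction n with
    | zero => simp
    | succ n ih =>
      have h1 : t n / t (n + 1) ≤ Real.exp |t n / t (n + 1) - 1| := by
        linarith [Real.add_one_le_exp |t n / t (n + 1) - 1|, le_abs_self (t n / t (n + 1) - 1)]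
      rw [div_le_iff₀ (ht _)] at h1
      calc t 0 ≤ t n * Real.exp (∑ k ∈ range n, |t k / t (k + 1) - 1|) := ih
        _ ≤ (Real.exp |t n / t (n + 1) - 1| * t (n + 1)) *
            Real.exp (∑ k ∈ range n, |t k / t (k + 1) - 1|) := by gcongr
        _ = _ := by rw [sum_range_succ, Real.exp_add]; ring
  refine ⟨t 0 * Real.exp (-∑' n, |t n / t (n + 1) - 1|), mul_pos (ht 0) (Real.exp_pos _),
    fun n => ?_⟩
  rw [Real.exp_neg, ← div_eq_mul_inv, div_le_iff₀ (Real.exp_pos _)]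
  refine (key n).trans (mul_le_mul_of_nonneg_left ?_ (ht n).le)
  exact Real.exp_le_exp.2 (hs.sum_le_tsum _ fun _ _ => abs_nonneg _)

/-- If `a (n + 1) ≤ r * a n + δ n` with `0 ≤ r < 1` and `δ → 0`, then `a → 0`. -/
theorem tendsto_zero_of_succ_le_mul_add {a δ : ℕ → ℝ} {r : ℝ} (hr0 : 0 ≤ r) (hr1 : r < 1)
    (ha : ∀ n, 0 ≤ a n) (hδ : Tendsto δ atTop (nhds 0)) (h : ∀ n, a (n + 1) ≤ r * a n + δ n) :
    Tendsto a atTop (nhds 0) := by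
  rw [tendsto_order]
  refine ⟨fun b hb => Eventually.of_forall fun n => hb.trans_le (ha n), fun ε hε => ?_⟩
  obtain ⟨m, hm⟩ := eventually_atTop.1
    (hδ.eventually (ge_mem_nhds (show 0 < (1 - r) * (ε / 2) by nlinarith)))
  have key : ∀ k, a (m + k) ≤ r ^ k * a m + ε / 2 := by
    intro k
    induction k with
    | zero => simp; linarith
    | succ k ih =>
      calc a (m + (k + 1)) ≤ r * a (m + k) + δ (m + k) := h _
        _ ≤ r * (r ^ k * a m + ε / 2) + (1 - r) * (ε / 2) := by
          gcongr
          exact hm _ (by omega)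
        _ = _ := by ring
  have hlim : Tendsto (fun k => r ^ k * a m) atTop (nhds 0) := by
    simpa using (tendsto_pow_atTop_nhds_zero_of_lt_one hr0 hr1).mul_const (a m)
  obtain ⟨k₀, hk₀⟩ := eventually_atTop.1 (hlim.eventually (gt_mem_nhds (half_pos hε)))
  refine eventually_atTop.2 ⟨m + k₀, fun n hn => ?_⟩
  obtain ⟨k, rfl⟩ := Nat.exists_eq_add_of_le (show m ≤ n by omega)
  linarith [key k, hk₀ k (by omega)]

/-- A stochastic matrix with entries at least `c` contracts, in `ℓ¹` norm, the row vectors of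
total mass zero by the factor `1 - c * card ι`. -/
theorem sum_abs_vecMul_le {ι : Type*} [Fintype ι] {A : Matrix ι ι ℝ} {c : ℝ}
    (hA : ∀ i j, c ≤ A i j) (hA1 : ∀ i, ∑ j, A i j = 1) {w : ι → ℝ} (hw : ∑ i, w i = 0) :
    ∑ j, |∑ i, w i * A i j| ≤ (1 - c * Fintype.card ι) * ∑ i, |w i| := by
  have h1 : ∀ j, |∑ i, w i * A i j| ≤ ∑ i, |w i| * (A i j - c) := by
    intro j
    have : ∑ i, w i * A i j = ∑ i, w i * (A i j - c) := by
      simp [mul_sub, sum_sub_distrib, ← sum_mul, hw]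
    rw [this]
    refine (abs_sum_le_sum_abs _ _).trans_eq (sum_congr rfl fun i _ => ?_)
    rw [abs_mul, abs_of_nonneg (sub_nonneg.2 (hA i j))]
  refine (sum_le_sum fun j _ => h1 j).trans_eq ?_
  rw [sum_comm, mul_sum]
  refine sum_congr rfl fun i _ => ?_
  rw [← mul_sum, sum_sub_distrib, hA1]
  simp
  ring

/-- Quasi-stationarity along all words gives a uniform positive lower bound on all entries. -/
theorem exists_pos_le_of_quasiStationary {ι : Type*} [Finite ι] [Nonempty ι]
    {T : ℕ → Matrix ι ι ℝ} (hpos : ∀ n i j, 0 < T n i j)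
    (hqs : ∀ x : ℕ → ι,
      Summable fun n => |T n (x n) (x (n + 1)) / T (n + 1) (x n) (x (n + 1)) - 1|) :
    ∃ c, 0 < c ∧ ∀ n i j, c ≤ T n i j := by
  have hentry : ∀ ij : ι × ι, ∃ c, 0 < c ∧ ∀ n, c ≤ T n ij.1 ij.2 := by
    rintro ⟨i, j⟩
    refine exists_pos_le_of_summable_abs_div_sub_one (fun n => hpos n i j) ?_
    refine Summable.of_nonneg_of_le (fun _ => abs_nonneg _) (fun n => ?_)
      ((hqs fun n => if Even n then i else j).add (hqs fun n => if Even n then j else i))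
    by_cases hn : Even n <;> simp [hn, Nat.even_add_one]
  choose c hc0 hc using hentry
  obtain ⟨p, hp⟩ := Finite.exists_min c
  exact ⟨c p, hc0 p, fun n i j => (hp (i, j)).trans (hc (i, j) n)⟩

/-- The rows of a product of stochastic matrices sum to `1`. -/
theorem sum_row_list_prod {ι : Type*} [Fintype ι] [DecidableEq ι] {T : ℕ → Matrix ι ι ℝ}
    (hT : ∀ n i, ∑ j, T n i j = 1) (l : List ℕ) (i : ι) : ∑ j, (l.map T).prod i j = 1 := by
  induction l generalizing i with
  | nil => simp [Matrix.one_apply]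
  | cons a l ih =>
    simp only [List.map_cons, List.prod_cons, Matrix.mul_apply]
    rw [sum_comm]
    simp [← mul_sum, ih, hT]

/-- Under the quasi-stationarity condition, with `T^(∞)` the entrywise limit
and `v` its Perron–Frobenius positive probability left eigenvector, the matrix products
`T^(p+1) T^(p+2) ⋯ T^(n)` converge entrywise, as `n → ∞`, to the matrix `Q` all of whose
rows equal `v`.  (Here `T k` denotes `T^(k+1)` of the paper, so the product
`T^(p+1) ⋯ T^(n)` is the product of `T k` for `k ∈ [p, n)`.) -/
theorem quasiStationary_products_tendsto (N : ℕ) (hN : 2 ≤ N)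
    (T : ℕ → Matrix (Fin N) (Fin N) ℝ)
    (hpos : ∀ n i j, 0 < T n i j)
    (hstoch : ∀ n i, ∑ j, T n i j = 1)
    (hqs : ∀ x : ℕ → Fin N,
      Summable fun n => |T n (x n) (x (n + 1)) / T (n + 1) (x n) (x (n + 1)) - 1|)
    (Tinf : Matrix (Fin N) (Fin N) ℝ)
    (hTinf : ∀ i j, Tendsto (fun n => T n i j) atTop (nhds (Tinf i j)))
    (v : Fin N → ℝ)
    (hvpos : ∀ i, 0 < v i) (hvsum : ∑ i, v i = 1)
    (hveig : ∀ j, ∑ i, v i * Tinf i j = v j) :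
    ∀ p : ℕ, 1 ≤ p → ∀ i j : Fin N,
      Tendsto (fun n => (((List.range' p (n - p)).map T).prod) i j) atTop (nhds (v j)) := by
  intro p _ i j
  have : Nonempty (Fin N) := ⟨⟨0, by omega⟩⟩
  obtain ⟨c, hc0, hc⟩ := exists_pos_le_of_quasiStationary hpos hqs
  set P : ℕ → Matrix (Fin N) (Fin N) ℝ := fun k => ((List.range' p k).map T).prod with hP
  have hPsucc : ∀ k, P (k + 1) = P k * T (p + k) := fun k => by
    simp [hP, List.range'_concat]
  have hr0 : 0 ≤ 1 - c * Fintype.card (Fin N) := by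
    have := sum_le_sum fun j (_ : j ∈ univ) => hc 0 i j
    rw [hstoch] at this
    simp at this ⊢
    linarith
  have hr1 : 1 - c * Fintype.card (Fin N) < 1 := by
    have : 0 < c * Fintype.card (Fin N) := by positivity
    linarith
  have hδ : Tendsto (fun k => ∑ j, |∑ l, v l * (T (p + k) l j - Tinf l j)|) atTop (nhds 0) := by
    have h : ∀ l j, Tendsto (fun k => T (p + k) l j) atTop (nhds (Tinf l j)) := fun l j => by
      simpa only [add_comm p] using (tendsto_add_atTop_iff_nat p).2 (hTinf l j)
    have := tendsto_finsetSum univ fun j _ => (tendsto_finsetSum univ fun l _ =>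
      ((h l j).sub_const (Tinf l j)).const_mul (v l)).abs
    simpa using this
  have hlim : Tendsto (fun k => ∑ j, |P k i j - v j|) atTop (nhds 0) := by
    refine tendsto_zero_of_succ_le_mul_add hr0 hr1 (fun k => sum_nonneg fun _ _ => abs_nonneg _)
      hδ fun k => ?_
    have hw : ∑ l, (P k i l - v l) = 0 := by
      rw [sum_sub_distrib, sum_row_list_prod hstoch, hvsum, sub_self]
    refine le_trans ?_ (add_le_add_left (sum_abs_vecMul_le (hc (p + k)) (hstoch (p + k)) hw) _)
    rw [← sum_add_distrib]
    refine sum_le_sum fun j _ => ?_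
    have : P (k + 1) i j - v j = ∑ l, (P k i l - v l) * T (p + k) l j +
        ∑ l, v l * (T (p + k) l j - Tinf l j) := by
      simp only [sub_mul, mul_sub, sum_sub_distrib, hveig, hPsucc, Matrix.mul_apply]
      ring
    rw [this]
    exact abs_add_le _ _
  have hcoord : Tendsto (fun k => P k i j) atTop (nhds (v j)) := by
    rw [tendsto_iff_norm_sub_tendsto_zero]
    refine squeeze_zero (fun _ => norm_nonneg _) (fun k => ?_) hlim
    exact single_le_sum (f := fun j => |P k i j - v j|) (fun _ _ => abs_nonneg _) (mem_univ j)
  exact hcoord.comp (tendsto_sub_atTop_nat p)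
end

section
/- Let μ be a quasi-stationary Markov measure on K_N associated to (λ, T). Then for every j ∈ Z_N, the pushforward measure μ∘σ_j^{-1} is absolutely continuous with respect to μ, and its Radon–Nikodym derivative is given μ-a.e. by d(μ∘σ_j^{-1})/dμ (x₁x₂…) = δ_{j,x₁} (λ_{x₂} / (λ_{x₁} T^(1)_{x₁,x₂})) F(x₂x₃…), where δ_{j,x₁} equals 1 if j = x₁ and 0 otherwise, and F(x₁x₂…) = ∏_{n=1}^∞ T^(n)_{x_n,x_{n+1}} / T^(n+1)_{x_n,x_{n+1}}. -/
open MeasureTheory Filter Finset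

/-- `IsMarkov μ l T` means that `μ` is the Markov measure on `K_N = ℕ → Fin N`
associated to the probability vector `l` and the sequence of transition matrices `T`
(with `T n` playing the role of `T^(n+1)` of the paper, and words indexed from `0`):
for every cylinder set determined by the first `n + 1` letters,
`μ(C(w₀ … w_n)) = l_{w₀} T^(1)_{w₀,w₁} ⋯ T^(n)_{w_{n-1},w_n}`. -/
def IsMarkov {N : ℕ} (μ : Measure (ℕ → Fin N)) (l : Fin N → ℝ)
    (T : ℕ → Matrix (Fin N) (Fin N) ℝ) : Prop :=
  ∀ (n : ℕ) (w : ℕ → Fin N),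
    μ {x | ∀ k ≤ n, x k = w k} =
      ENNReal.ofReal (l (w 0) * ∏ k ∈ Finset.range n, T k (w k) (w (k + 1)))

/-- The map `x₀x₁… ↦ j x₀x₁…` prepending the letter `j` to an infinite word. -/
def prependLetter {N : ℕ} (j : Fin N) (x : ℕ → Fin N) (k : ℕ) : Fin N :=
  if k = 0 then j else x (k - 1)

/-- The ratio `T^(n+1)_{a,b} / T^(n+2)_{a,b}` of consecutive transition probabilities. -/
noncomputable def transitionRatio {N : ℕ} (T : ℕ → Matrix (Fin N) (Fin N) ℝ) (n : ℕ)
    (a b : Fin N) : ℝ :=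
  T n a b / T (n + 1) a b

/-- The factor of the density of the pushforward that depends on the first two letters only. -/
noncomputable def densityHead {N : ℕ} (l : Fin N → ℝ) (T : ℕ → Matrix (Fin N) (Fin N) ℝ)
    (j a b : Fin N) : ℝ :=
  (if a = j then (1 : ℝ) else 0) * (l b / (l a * T 0 a b))

/-- The density with its infinite product truncated after `n` factors. -/
noncomputable def truncatedDensity {N : ℕ} (l : Fin N → ℝ) (T : ℕ → Matrix (Fin N) (Fin N) ℝ)
    (j : Fin N) (n : ℕ) (x : ℕ → Fin N) : ℝ :=
  densityHead l T j (x 0) (x 1) *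
    ∏ k ∈ Finset.range n, transitionRatio T k (x (k + 1)) (x (k + 2))

lemma measurable_prependLetter {N : ℕ} (j : Fin N) : Measurable (prependLetter j) := by
  refine measurable_pi_lambda _ fun k => ?_
  unfold prependLetter
  split_ifs
  · exact measurable_const
  · exact measurable_pi_apply _

lemma measurable_truncatedDensity {N : ℕ} (l : Fin N → ℝ) (T : ℕ → Matrix (Fin N) (Fin N) ℝ)
    (j : Fin N) (n : ℕ) : Measurable (truncatedDensity l T j n) := by
  have hpair (g : Fin N → Fin N → ℝ) (a b : ℕ) :
      Measurable fun x : ℕ → Fin N => g (x a) (x b) :=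
    (measurable_of_countable fun p : Fin N × Fin N => g p.1 p.2).comp
      (f := fun x : ℕ → Fin N => (x a, x b))
      ((measurable_pi_apply a).prodMk (measurable_pi_apply b))
  exact (hpair _ 0 1).mul (Finset.measurable_fun_prod _ fun k _ => hpair _ (k + 1) (k + 2))

lemma measurableSet_piNat_cylinder {N : ℕ} (w : ℕ → Fin N) (n : ℕ) :
    MeasurableSet (PiNat.cylinder w n) :=
  (PiNat.isOpen_cylinder (fun _ => Fin N) w n).measurableSet

lemma measure_piNat_cylinder_eq_sum {N : ℕ} (μ : Measure (ℕ → Fin N)) (w : ℕ → Fin N) (n : ℕ) :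
    μ (PiNat.cylinder w n) = ∑ i, μ (PiNat.cylinder (Function.update w n i) (n + 1)) := by
  rw [← PiNat.iUnion_cylinder_update w n, measure_iUnion, tsum_fintype]
  · intro a b hab
    refine Set.disjoint_left.2 fun x hxa hxb => hab ?_
    have ha := hxa n (Nat.lt_succ_self n)
    have hb := hxb n (Nat.lt_succ_self n)
    simp only [Function.update_self] at ha hb
    exact ha.symm.trans hb
  · exact fun i => measurableSet_piNat_cylinder _ _

lemma measure_piNat_cylinder_eq_of_le {N : ℕ} {μ ν : Measure (ℕ → Fin N)} {m n : ℕ}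
    (hmn : m ≤ n) (h : ∀ w, μ (PiNat.cylinder w n) = ν (PiNat.cylinder w n)) (w : ℕ → Fin N) :
    μ (PiNat.cylinder w m) = ν (PiNat.cylinder w m) := by
  induction n, hmn using Nat.le_induction with
  | base => exact h w
  | succ k _ ih =>
    refine ih fun v => ?_
    rw [measure_piNat_cylinder_eq_sum, measure_piNat_cylinder_eq_sum]
    exact Finset.sum_congr rfl fun i _ => h _

/-- Finite measures on the space of infinite words agree if they agree on cylinders. -/
lemma MeasureTheory.Measure.ext_of_piNat_cylinder {N : ℕ} {μ ν : Measure (ℕ → Fin N)}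
    [IsFiniteMeasure μ] (h : ∀ w n, μ (PiNat.cylinder w n) = ν (PiNat.cylinder w n)) :
    μ = ν := by
  have hbasis := PiNat.isTopologicalBasis_cylinders (fun _ : ℕ => Fin N)
  refine ext_of_generate_finite {s | ∃ (x : ℕ → Fin N) (n : ℕ), s = PiNat.cylinder x n}
    ?_ ?_ ?_ ?_
  · rw [← hbasis.borel_eq_generateFrom]
    exact BorelSpace.measurable_eq
  · rintro _ ⟨x, m, rfl⟩ _ ⟨y, n, rfl⟩ ⟨z, hzx, hzy⟩
    refine ⟨z, max m n, ?_⟩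
    rw [← PiNat.mem_cylinder_iff_eq.1 hzx, ← PiNat.mem_cylinder_iff_eq.1 hzy]
    ext y
    simp only [Set.mem_inter_iff, PiNat.mem_cylinder_iff, lt_max_iff]
    exact ⟨fun hy i hi => hi.elim (hy.1 i) (hy.2 i),
      fun hy => ⟨fun i hi => hy i (.inl hi), fun i hi => hy i (.inr hi)⟩⟩
  · rintro _ ⟨x, n, rfl⟩
    exact h x n
  · rcases isEmpty_or_nonempty (ℕ → Fin N) with _ | ⟨⟨x⟩⟩
    · simp [Set.univ_eq_empty_iff.2 ‹_›]
    · simpa using h x 0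

lemma IsMarkov.measure_piNat_cylinder {N : ℕ} {μ : Measure (ℕ → Fin N)} {l : Fin N → ℝ}
    {T : ℕ → Matrix (Fin N) (Fin N) ℝ} (hμ : IsMarkov μ l T) (w : ℕ → Fin N) (n : ℕ) :
    μ (PiNat.cylinder w (n + 1)) =
      ENNReal.ofReal (l (w 0) * ∏ k ∈ Finset.range n, T k (w k) (w (k + 1))) := by
  rw [← hμ n w]
  congr 1
  ext x
  simp [PiNat.mem_cylinder_iff]

lemma prependLetter_preimage_piNat_cylinder {N : ℕ} (j : Fin N) (w : ℕ → Fin N) (n : ℕ) :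
    prependLetter j ⁻¹' PiNat.cylinder w (n + 1) =
      if w 0 = j then PiNat.cylinder (fun k => w (k + 1)) n else ∅ := by
  ext x
  split_ifs with h
  · simp only [Set.mem_preimage, PiNat.mem_cylinder_iff, prependLetter]
    constructor
    · intro hx i hi
      simpa using hx (i + 1) (by omega)
    · rintro hx (_ | i) hi
      · simp [h]
      · simpa using hx i (by omega)
  · simp only [Set.mem_preimage, PiNat.mem_cylinder_iff, prependLetter, Set.mem_empty_iff_false,
      iff_false]
    intro hx
    exact h (by simpa using (hx 0 (Nat.succ_pos n)).symm)

lemma truncatedDensity_eq_of_mem_cylinder {N : ℕ} (l : Fin N → ℝ)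
    (T : ℕ → Matrix (Fin N) (Fin N) ℝ) (j : Fin N) (n : ℕ) {w x : ℕ → Fin N}
    (hx : x ∈ PiNat.cylinder w (n + 2)) :
    truncatedDensity l T j n x = truncatedDensity l T j n w := by
  unfold truncatedDensity
  rw [hx 0 (by omega), hx 1 (by omega)]
  congr 1
  refine Finset.prod_congr rfl fun k hk => ?_
  have := Finset.mem_range.1 hk
  rw [hx (k + 1) (by omega), hx (k + 2) (by omega)]

/-- The truncated density is the density of the pushforward on long enough cylinders. -/
lemma map_prependLetter_cylinder {N : ℕ} {l : Fin N → ℝ} {T : ℕ → Matrix (Fin N) (Fin N) ℝ}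
    (hl : ∀ i, 0 < l i) (hpos : ∀ n i j, 0 < T n i j) {μ : Measure (ℕ → Fin N)}
    (hμ : IsMarkov μ l T) (j : Fin N) (n : ℕ) (w : ℕ → Fin N) :
    μ.map (prependLetter j) (PiNat.cylinder w (n + 2)) =
      μ.withDensity (fun x => ENNReal.ofReal (truncatedDensity l T j n x))
        (PiNat.cylinder w (n + 2)) := by
  have hcyl := measurableSet_piNat_cylinder w (n + 2)
  rw [Measure.map_apply (measurable_prependLetter j) hcyl, withDensity_apply _ hcyl,
    setLIntegral_congr_fun hcyl (g := fun _ => ENNReal.ofReal (truncatedDensity l T j n w))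
      (fun x hx => by simp only [truncatedDensity_eq_of_mem_cylinder l T j n hx]),
    setLIntegral_const, prependLetter_preimage_piNat_cylinder, hμ.measure_piNat_cylinder]
  split_ifs with h
  · rw [hμ.measure_piNat_cylinder, ← ENNReal.ofReal_mul']
    · congr 1
      have h0 := (hl (w 0)).ne'
      have h1 := (hpos 0 (w 0) (w 1)).ne'
      have h2 : (∏ k ∈ Finset.range n, T (k + 1) (w (k + 1)) (w (k + 2))) ≠ 0 :=
        Finset.prod_ne_zero_iff.2 fun k _ => (hpos _ _ _).ne'
      rw [Finset.prod_range_succ']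
      simp only [truncatedDensity, densityHead, transitionRatio, h, if_true,
        Finset.prod_div_distrib, zero_add] at *
      field_simp
    · exact mul_nonneg (hl _).le (Finset.prod_nonneg fun k _ => (hpos _ _ _).le)
  · simp [truncatedDensity, densityHead, h]

/-- Summability along every path upgrades to summability uniformly over pairs of letters. -/
lemma summable_sum_of_summable_path {N : ℕ} {a : ℕ → Fin N → Fin N → ℝ}
    (ha : ∀ n i j, 0 ≤ a n i j) (h : ∀ x : ℕ → Fin N, Summable fun n => a n (x n) (x (n + 1))) :
    Summable fun n => ∑ i, ∑ j, a n i j := by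
  refine summable_sum fun i _ => summable_sum fun j _ => ?_
  refine Summable.of_nonneg_of_le (fun n => ha n i j) (fun n => ?_)
    ((h fun n => if Even n then i else j).add (h fun n => if Even n then j else i))
  rcases Nat.even_or_odd n with hn | hn
  · simp [hn, Nat.even_add_one, ha]
  · simp [Nat.not_even_iff_odd.2 hn, Nat.even_add_one, ha]

lemma exists_truncatedDensity_le {N : ℕ} {l : Fin N → ℝ} {T : ℕ → Matrix (Fin N) (Fin N) ℝ}
    (hl : ∀ i, 0 < l i) (hpos : ∀ n i j, 0 < T n i j)
    (hqs : ∀ x : ℕ → Fin N, Summable fun n => |transitionRatio T n (x n) (x (n + 1)) - 1|)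
    (j : Fin N) : ∃ C, ∀ n x, truncatedDensity l T j n x ≤ C := by
  have hS := summable_sum_of_summable_path (a := fun n a b => |transitionRatio T n a b - 1|)
    (fun _ _ _ => abs_nonneg _) hqs
  set S : ℕ → ℝ := fun n => ∑ a, ∑ b, |transitionRatio T n a b - 1| with hSdef
  have hS0 (n : ℕ) : 0 ≤ S n :=
    Finset.sum_nonneg fun _ _ => Finset.sum_nonneg fun _ _ => abs_nonneg _
  have hratio (n : ℕ) (a b : Fin N) : transitionRatio T n a b ≤ Real.exp (S n) := by
    have h1 : |transitionRatio T n a b - 1| ≤ ∑ b, |transitionRatio T n a b - 1| :=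
      Finset.single_le_sum (f := fun b => |transitionRatio T n a b - 1|)
        (fun _ _ => abs_nonneg _) (Finset.mem_univ b)
    have h2 : ∑ b, |transitionRatio T n a b - 1| ≤ S n :=
      Finset.single_le_sum (f := fun a => ∑ b, |transitionRatio T n a b - 1|)
        (fun _ _ => Finset.sum_nonneg fun _ _ => abs_nonneg _) (Finset.mem_univ a)
    linarith [le_abs_self (transitionRatio T n a b - 1), Real.add_one_le_exp (S n)]
  have hratio0 (n : ℕ) (a b : Fin N) : 0 ≤ transitionRatio T n a b :=
    (div_pos (hpos _ _ _) (hpos _ _ _)).le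
  have hhead0 (a b : Fin N) : 0 ≤ densityHead l T j a b :=
    mul_nonneg (by split_ifs <;> norm_num)
      (div_pos (hl _) (mul_pos (hl _) (hpos _ _ _))).le
  refine ⟨(∑ a, ∑ b, densityHead l T j a b) * Real.exp (∑' n, S n), fun n x => ?_⟩
  refine mul_le_mul ?_ ?_ (Finset.prod_nonneg fun _ _ => hratio0 _ _ _)
    (Finset.sum_nonneg fun _ _ => Finset.sum_nonneg fun _ _ => hhead0 _ _)
  · refine (Finset.single_le_sum (f := fun b => densityHead l T j (x 0) b)
      (fun _ _ => hhead0 _ _) (Finset.mem_univ (x 1))).trans ?_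
    exact Finset.single_le_sum (f := fun a => ∑ b, densityHead l T j a b)
      (fun _ _ => Finset.sum_nonneg fun _ _ => hhead0 _ _) (Finset.mem_univ (x 0))
  · refine (Finset.prod_le_prod (fun _ _ => hratio0 _ _ _) fun k _ => hratio k _ _).trans ?_
    rw [← Real.exp_sum]
    exact Real.exp_le_exp.2 (hS.sum_le_tsum _ fun k _ => hS0 k)

lemma tendsto_truncatedDensity {N : ℕ} (l : Fin N → ℝ) {T : ℕ → Matrix (Fin N) (Fin N) ℝ}
    (hqs : ∀ x : ℕ → Fin N, Summable fun n => |transitionRatio T n (x n) (x (n + 1)) - 1|)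
    (j : Fin N) (x : ℕ → Fin N) :
    Tendsto (fun n => truncatedDensity l T j n x) atTop
      (nhds (densityHead l T j (x 0) (x 1) *
        ∏' n : ℕ, transitionRatio T n (x (n + 1)) (x (n + 2)))) := by
  have hmul : Multipliable fun n => transitionRatio T n (x (n + 1)) (x (n + 2)) := by
    have h := multipliable_one_add_of_summable
      (f := fun n => transitionRatio T n (x (n + 1)) (x (n + 2)) - 1)
      (hqs fun n => x (n + 1))
    simpa using h
  exact hmul.hasProd.tendsto_prod_nat.const_mul _

lemma map_prependLetter_eq_withDensity {N : ℕ} {l : Fin N → ℝ}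
    {T : ℕ → Matrix (Fin N) (Fin N) ℝ} (hl : ∀ i, 0 < l i) (hpos : ∀ n i j, 0 < T n i j)
    {μ : Measure (ℕ → Fin N)} [IsFiniteMeasure μ] (hμ : IsMarkov μ l T) (j : Fin N)
    {f : (ℕ → Fin N) → ℝ} {C : ℝ} (hC : ∀ n x, truncatedDensity l T j n x ≤ C)
    (hf : ∀ x, Tendsto (fun n => truncatedDensity l T j n x) atTop (nhds (f x))) :
    μ.map (prependLetter j) = μ.withDensity fun x => ENNReal.ofReal (f x) := by
  refine Measure.ext_of_piNat_cylinder fun w m => ?_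
  have hcyl := measurableSet_piNat_cylinder w m
  have hlim : Tendsto
      (fun n => ∫⁻ x in PiNat.cylinder w m, ENNReal.ofReal (truncatedDensity l T j n x) ∂μ) atTop
      (nhds (∫⁻ x in PiNat.cylinder w m, ENNReal.ofReal (f x) ∂μ)) := by
    refine tendsto_lintegral_of_dominated_convergence (fun _ => ENNReal.ofReal C)
      (fun n => (measurable_truncatedDensity l T j n).ennreal_ofReal)
      (fun n => .of_forall fun x => ENNReal.ofReal_le_ofReal (hC n x)) ?_
      (.of_forall fun x => (ENNReal.continuous_ofReal.tendsto _).comp (hf x))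
    rw [lintegral_const]
    exact ENNReal.mul_ne_top ENNReal.ofReal_ne_top (measure_ne_top _ _)
  rw [withDensity_apply _ hcyl]
  refine tendsto_nhds_unique (tendsto_const_nhds.congr' ?_) hlim
  filter_upwards [eventually_ge_atTop m] with n hn
  rw [← withDensity_apply _ hcyl]
  exact measure_piNat_cylinder_eq_of_le (by omega : m ≤ n + 2)
    (map_prependLetter_cylinder hl hpos hμ j n) w

/-- For a quasi-stationary Markov measure `μ` associated to `(λ, T)` and
`j ∈ Z_N`, the pushforward `μ ∘ σ_j⁻¹` is absolutely continuous w.r.t. `μ` with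
Radon–Nikodym derivative
`(x₁x₂…) ↦ δ_{j,x₁} (λ_{x₂}/(λ_{x₁}T^(1)_{x₁,x₂})) F(x₂x₃…)`, where
`F(y₁y₂…) = ∏_{n=1}^∞ T^(n)_{y_n,y_{n+1}} / T^(n+1)_{y_n,y_{n+1}}`. -/
theorem pullback_absolutelyContinuous_rnDeriv (N : ℕ) (hN : 2 ≤ N)
    (l : Fin N → ℝ) (T : ℕ → Matrix (Fin N) (Fin N) ℝ)
    (hl : ∀ i, 0 < l i) (hlsum : ∑ i, l i = 1)
    (hpos : ∀ n i j, 0 < T n i j) (hstoch : ∀ n i, ∑ j, T n i j = 1)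
    (hfix : ∀ j, ∑ i, l i * T 0 i j = l j)
    (μ : Measure (ℕ → Fin N)) [IsProbabilityMeasure μ]
    (hμ : IsMarkov μ l T)
    (hqs : ∀ x : ℕ → Fin N,
      Summable fun n => |T n (x n) (x (n + 1)) / T (n + 1) (x n) (x (n + 1)) - 1|)
    (j : Fin N) :
    μ.map (fun (x : ℕ → Fin N) (k : ℕ) => if k = 0 then j else x (k - 1)) ≪ μ ∧
    (μ.map (fun (x : ℕ → Fin N) (k : ℕ) => if k = 0 then j else x (k - 1))).rnDeriv μ
      =ᵐ[μ] fun x => ENNReal.ofReal ((if x 0 = j then (1 : ℝ) else 0) *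
        (l (x 1) / (l (x 0) * T 0 (x 0) (x 1))) *
        ∏' n : ℕ, T n (x (n + 1)) (x (n + 2)) / T (n + 1) (x (n + 1)) (x (n + 2))) := by
  obtain ⟨C, hC⟩ := exists_truncatedDensity_le hl hpos hqs j
  have hlim := tendsto_truncatedDensity l hqs j
  have hmeas := measurable_of_tendsto_metrizable (measurable_truncatedDensity l T j)
    (tendsto_pi_nhds.2 hlim)
  have hmap := map_prependLetter_eq_withDensity hl hpos hμ j hC hlim
  change μ.map (prependLetter j) ≪ μ ∧ (μ.map (prependLetter j)).rnDeriv μ =ᵐ[μ] _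
  rw [hmap]
  exact ⟨withDensity_absolutelyContinuous _ _, Measure.rnDeriv_withDensity _ hmeas.ennreal_ofReal⟩
end

section
/- Let μ be a quasi-stationary Markov measure on K_N associated to (λ, T). Then the pushforward measure μ∘σ^{-1} under the shift σ is absolutely continuous with respect to μ, and its Radon–Nikodym derivative is given μ-a.e. by d(μ∘σ^{-1})/dμ (x₁x₂…) = 1 / F(x₁x₂…), where F(x₁x₂…) = ∏_{n=1}^∞ T^(n)_{x_n,x_{n+1}} / T^(n+1)_{x_n,x_{n+1}}. -/
open MeasureTheory Filter Finset

/-- If a nonnegative function of the transitions is summable along every path, then it is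
dominated by a summable sequence, uniformly in the transition. -/
lemma exists_summable_bound_of_summable_paths {α : Type*} [Finite α] [Nonempty α]
    (a : ℕ → α → α → ℝ) (ha : ∀ n i j, 0 ≤ a n i j)
    (hsum : ∀ x : ℕ → α, Summable fun n => a n (x n) (x (n + 1))) :
    ∃ M : ℕ → ℝ, Summable M ∧ ∀ n i j, a n i j ≤ M n := by
  choose p hp using fun n => Finite.exists_max fun q : α × α => a n q.1 q.2
  refine ⟨fun n => a n (p n).1 (p n).2, ?_, fun n i j => hp n (i, j)⟩
  refine Summable.of_nonneg_of_le (fun n => ha _ _ _) (fun n => ?_)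
    ((hsum fun k => if Even k then (p k).1 else (p (k - 1)).2).add
      (hsum fun k => if Even k then (p (k - 1)).2 else (p k).1))
  by_cases hn : Even n <;> simp [hn, Nat.even_add_one, ha]

/-- Summability of `|r n - 1|` passes to the inverses. -/
lemma summable_abs_inv_sub_one {r : ℕ → ℝ} (h : Summable fun n => |r n - 1|) :
    Summable fun n => |(r n)⁻¹ - 1| := by
  refine Summable.of_norm_bounded_eventually_nat (h.mul_left 2) ?_
  filter_upwards [h.tendsto_atTop_zero.eventually (gt_mem_nhds (by norm_num : (0 : ℝ) < 1 / 2))]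
    with n hn
  have hr : 1 / 2 < r n := by linarith [(abs_lt.1 hn).1]
  have hr0 : 0 < r n := by linarith
  have hinv : (r n)⁻¹ ≤ 2 := by
    rw [inv_le_comm₀ hr0 two_pos]; linarith
  have heq : (r n)⁻¹ - 1 = (r n)⁻¹ * -(r n - 1) := by field_simp; ring
  rw [Real.norm_eq_abs, abs_abs, heq, abs_mul, abs_neg, abs_of_pos (inv_pos.2 hr0)]
  gcongr

/-- Real sequences with summable distance to `1` are multipliable. -/
lemma multipliable_of_summable_abs_sub_one {r : ℕ → ℝ} (h : Summable fun n => |r n - 1|) :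
    Multipliable r := by
  simpa using multipliable_one_add_of_summable (f := fun n => r n - 1) h

/-- The partial products of the inverses converge to the inverse of the infinite product. -/
lemma tendsto_prod_inv_one_div_tprod {r : ℕ → ℝ} (hr : ∀ n, r n ≠ 0)
    (h : Summable fun n => |r n - 1|) :
    Tendsto (fun n => ∏ k ∈ range n, (r k)⁻¹) atTop (nhds (1 / ∏' n, r n)) := by
  have hm := multipliable_of_summable_abs_sub_one h
  have hm' := multipliable_of_summable_abs_sub_one (summable_abs_inv_sub_one h)
  have hmul : (∏' n, (r n)⁻¹) * ∏' n, r n = 1 := by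
    rw [← hm'.tprod_mul hm]
    simp [hr]
  rw [← eq_one_div_of_mul_eq_one_left hmul]
  exact hm'.hasProd.tendsto_prod_nat

/-- Partial products of nonnegative numbers within summable distance of `1` are bounded. -/
lemma prod_range_le_exp_tsum {b M : ℕ → ℝ} (hb : ∀ n, 0 ≤ b n) (hM : Summable M)
    (hbM : ∀ n, |b n - 1| ≤ M n) (n : ℕ) :
    ∏ k ∈ range n, b k ≤ Real.exp (∑' k, M k) := by
  calc ∏ k ∈ range n, b k ≤ ∏ k ∈ range n, Real.exp (M k) := by
        refine prod_le_prod (fun k _ => hb k) fun k _ => ?_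
        linarith [le_abs_self (b k - 1), hbM k, Real.add_one_le_exp (M k)]
    _ = Real.exp (∑ k ∈ range n, M k) := (Real.exp_sum _ _).symm
    _ ≤ Real.exp (∑' k, M k) := Real.exp_le_exp.2
        (hM.sum_le_tsum _ fun k _ => (abs_nonneg _).trans (hbM k))

/-- Two measures on sequences agreeing on the cylinders of length `n + 1` agree on every set
determined by the coordinates up to `n`. -/
lemma measure_cylinder_Iic_eq {α : Type*} [Countable α] [MeasurableSpace α]
    [MeasurableSingletonClass α] {μ ν : Measure (ℕ → α)} {n : ℕ}
    (h : ∀ w : ℕ → α, μ {x | ∀ k ≤ n, x k = w k} = ν {x | ∀ k ≤ n, x k = w k})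
    (S : Set (Iic n → α)) : μ (cylinder (Iic n) S) = ν (cylinder (Iic n) S) := by
  have hg : Measurable ((Iic n).restrict : (ℕ → α) → (Iic n → α)) :=
    Finset.measurable_restrict _
  have hmap : μ.map (Iic n).restrict = ν.map (Iic n).restrict := by
    refine Measure.ext_of_singleton fun v => ?_
    rw [Measure.map_apply hg (measurableSet_singleton v),
      Measure.map_apply hg (measurableSet_singleton v)]
    have hpre : ((Iic n).restrict : (ℕ → α) → (Iic n → α)) ⁻¹' {v} =
        {x | ∀ k ≤ n, x k = v ⟨min k n, by simp⟩} := by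
      ext x
      simp only [Set.mem_preimage, Set.mem_singleton_iff, funext_iff, Subtype.forall, mem_Iic,
        Finset.restrict_def, Set.mem_ofPred_eq]
      refine forall₂_congr fun k hk => ?_
      simp [min_eq_left hk]
    rw [hpre]
    exact h fun k => v ⟨min k n, by simp⟩
  have hS : MeasurableSet S := S.to_countable.measurableSet
  simpa only [Measure.map_apply hg hS, cylinder] using DFunLike.congr_fun hmap S

/-- A cylinder over the coordinates up to `n` is measurable. -/
lemma measurableSet_setOf_forall_le_eq {α : Type*} [MeasurableSpace α]
    [MeasurableSingletonClass α] (n : ℕ) (w : ℕ → α) :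
    MeasurableSet {x : ℕ → α | ∀ k ≤ n, x k = w k} := by
  simp only [Set.ofPred_forall]
  exact .iInter fun k => .iInter fun _ =>
    (measurableSet_singleton (w k)).preimage (measurable_pi_apply k)

/-- The shifted Markov measure of a cylinder. -/
lemma IsMarkov.map_shift_cylinder {N : ℕ} {μ : Measure (ℕ → Fin N)} {l : Fin N → ℝ}
    {T : ℕ → Matrix (Fin N) (Fin N) ℝ} (hμ : IsMarkov μ l T) (hl : ∀ i, 0 ≤ l i)
    (hT : ∀ n i j, 0 ≤ T n i j) (hfix : ∀ j, ∑ i, l i * T 0 i j = l j)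
    (n : ℕ) (w : ℕ → Fin N) :
    μ.map (fun (x : ℕ → Fin N) (k : ℕ) => x (k + 1)) {x | ∀ k ≤ n, x k = w k} =
      ENNReal.ofReal (l (w 0) * ∏ k ∈ range n, T (k + 1) (w k) (w (k + 1))) := by
  let v (i : Fin N) (k : ℕ) : Fin N := Nat.casesOn k i w
  have hpre : (fun (x : ℕ → Fin N) (k : ℕ) => x (k + 1)) ⁻¹' {x | ∀ k ≤ n, x k = w k} =
      ⋃ i, {x | ∀ k ≤ n + 1, x k = v i k} := by
    ext x
    simp only [Set.mem_preimage, Set.mem_ofPred_eq, Set.mem_iUnion]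
    constructor
    · refine fun h => ⟨x 0, fun k hk => ?_⟩
      cases k with
      | zero => rfl
      | succ k => exact h k (by omega)
    · rintro ⟨i, h⟩ k hk
      exact h (k + 1) (by omega)
  have hdisj : Pairwise (Function.onFun Disjoint
      fun i => {x : ℕ → Fin N | ∀ k ≤ n + 1, x k = v i k}) := fun i j hij =>
    Set.disjoint_left.2 fun x hi hj => hij ((hi 0 (by omega)).symm.trans (hj 0 (by omega)))
  rw [Measure.map_apply (by fun_prop) (measurableSet_setOf_forall_le_eq n w), hpre,
    measure_iUnion hdisj fun i => measurableSet_setOf_forall_le_eq _ _, tsum_fintype,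
    ← hfix (w 0), sum_mul, ENNReal.ofReal_sum_of_nonneg fun i _ =>
      mul_nonneg (mul_nonneg (hl i) (hT _ _ _)) (prod_nonneg fun k _ => hT _ _ _)]
  refine sum_congr rfl fun i _ => ?_
  rw [hμ (n + 1) (v i), prod_range_succ']
  congr 1
  change l i * (_ * T 0 i (w 0)) = _
  rw [mul_left_comm, mul_comm]

/-- On sets determined by the coordinates up to `n`, the shifted Markov measure has density
`∏ k < n, T^(k+1) / T^(k)` with respect to the Markov measure. -/
lemma IsMarkov.map_shift_cylinder_eq_setLIntegral {N : ℕ} {μ : Measure (ℕ → Fin N)}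
    {l : Fin N → ℝ} {T : ℕ → Matrix (Fin N) (Fin N) ℝ} (hμ : IsMarkov μ l T)
    (hl : ∀ i, 0 ≤ l i) (hT : ∀ n i j, 0 < T n i j) (hfix : ∀ j, ∑ i, l i * T 0 i j = l j)
    (n : ℕ) (S : Set (Iic n → Fin N)) :
    μ.map (fun (x : ℕ → Fin N) (k : ℕ) => x (k + 1)) (cylinder (Iic n) S) =
      ∫⁻ x in cylinder (Iic n) S, ENNReal.ofReal
        (∏ k ∈ range n, (T k (x k) (x (k + 1)) / T (k + 1) (x k) (x (k + 1)))⁻¹) ∂μ := by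
  rw [← withDensity_apply _ ((S.to_countable.measurableSet).cylinder _)]
  refine measure_cylinder_Iic_eq (fun w => ?_) S
  have hC := measurableSet_setOf_forall_le_eq n w
  rw [hμ.map_shift_cylinder hl (fun n i j => (hT n i j).le) hfix, withDensity_apply _ hC,
    setLIntegral_congr_fun (g := fun _ => ENNReal.ofReal
      (∏ k ∈ range n, (T k (w k) (w (k + 1)) / T (k + 1) (w k) (w (k + 1)))⁻¹)) hC,
    setLIntegral_const, hμ n w, ← ENNReal.ofReal_mul]
  · congr 1
    rw [mul_left_comm, ← prod_mul_distrib]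
    congr 1
    refine prod_congr rfl fun k _ => ?_
    field_simp [(hT k (w k) (w (k + 1))).ne', (hT (k + 1) (w k) (w (k + 1))).ne']
  · exact prod_nonneg fun k _ => inv_nonneg.2 (div_nonneg (hT _ _ _).le (hT _ _ _).le)
  · intro x hx
    simp only
    congr 1
    refine prod_congr rfl fun k hk => ?_
    have hk := mem_range.1 hk
    rw [hx k (by omega), hx (k + 1) (by omega)]

/-- A family of transition weights, evaluated along a path, is measurable. -/
lemma measurable_transition {N : ℕ} (g : Fin N → Fin N → ℝ) (k : ℕ) :
    Measurable fun x : ℕ → Fin N => g (x k) (x (k + 1)) :=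
  Measurable.comp (g := fun p : Fin N × Fin N => g p.1 p.2)
    (f := fun x : ℕ → Fin N => (x k, x (k + 1))) (measurable_of_finite _)
    ((measurable_pi_apply k).prodMk (measurable_pi_apply (k + 1)))

/-- For a quasi-stationary Markov measure `μ` associated to `(λ, T)`,
the pushforward `μ ∘ σ⁻¹` under the shift is absolutely continuous w.r.t. `μ` with
Radon–Nikodym derivative `x ↦ 1 / F(x)` where
`F(x₁x₂…) = ∏_{n=1}^∞ T^(n)_{x_n,x_{n+1}} / T^(n+1)_{x_n,x_{n+1}}`. -/
theorem shift_pushforward_absolutelyContinuous_rnDeriv (N : ℕ) (hN : 2 ≤ N)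
    (l : Fin N → ℝ) (T : ℕ → Matrix (Fin N) (Fin N) ℝ)
    (hl : ∀ i, 0 < l i) (hlsum : ∑ i, l i = 1)
    (hpos : ∀ n i j, 0 < T n i j) (hstoch : ∀ n i, ∑ j, T n i j = 1)
    (hfix : ∀ j, ∑ i, l i * T 0 i j = l j)
    (μ : Measure (ℕ → Fin N)) [IsProbabilityMeasure μ]
    (hμ : IsMarkov μ l T)
    (hqs : ∀ x : ℕ → Fin N,
      Summable fun n => |T n (x n) (x (n + 1)) / T (n + 1) (x n) (x (n + 1)) - 1|) :
    μ.map (fun (x : ℕ → Fin N) (k : ℕ) => x (k + 1)) ≪ μ ∧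
    (μ.map (fun (x : ℕ → Fin N) (k : ℕ) => x (k + 1))).rnDeriv μ =ᵐ[μ]
      fun x => ENNReal.ofReal
        (1 / ∏' n : ℕ, T n (x n) (x (n + 1)) / T (n + 1) (x n) (x (n + 1))) := by
  have : Nonempty (Fin N) := ⟨⟨0, by omega⟩⟩
  have hrpos : ∀ n i j, 0 < T n i j / T (n + 1) i j := fun n i j =>
    div_pos (hpos _ _ _) (hpos _ _ _)
  obtain ⟨M, hM, hbM⟩ := exists_summable_bound_of_summable_paths
    (fun n i j => |(T n i j / T (n + 1) i j)⁻¹ - 1|) (fun _ _ _ => abs_nonneg _)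
    fun x => summable_abs_inv_sub_one (hqs x)
  let f (n : ℕ) (x : ℕ → Fin N) : ENNReal := ENNReal.ofReal
    (∏ k ∈ range n, (T k (x k) (x (k + 1)) / T (k + 1) (x k) (x (k + 1)))⁻¹)
  have hf : ∀ n, Measurable (f n) := fun n => ENNReal.measurable_ofReal.comp
    (Finset.measurable_prod _ fun k _ =>
      measurable_transition (fun i j => (T k i j / T (k + 1) i j)⁻¹) k)
  have hbound : ∀ n x, f n x ≤ ENNReal.ofReal (Real.exp (∑' k, M k)) := fun n x =>
    ENNReal.ofReal_le_ofReal (prod_range_le_exp_tsum (fun k => (inv_pos.2 (hrpos _ _ _)).le) hM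
      (fun k => hbM k (x k) (x (k + 1))) n)
  have hlim : ∀ x, Tendsto (fun n => f n x) atTop (nhds (ENNReal.ofReal
      (1 / ∏' n : ℕ, T n (x n) (x (n + 1)) / T (n + 1) (x n) (x (n + 1))))) := fun x =>
    ENNReal.tendsto_ofReal
      (tendsto_prod_inv_one_div_tprod (fun n => (hrpos _ _ _).ne') (hqs x))
  have hlim_meas := measurable_of_tendsto_metrizable hf (tendsto_pi_nhds.2 hlim)
  have hshift : Measurable fun (x : ℕ → Fin N) (k : ℕ) => x (k + 1) := by fun_prop
  have : IsProbabilityMeasure (μ.map fun (x : ℕ → Fin N) (k : ℕ) => x (k + 1)) :=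
    Measure.isProbabilityMeasure_map hshift.aemeasurable
  have hcyl : ∀ A ∈ measurableCylinders (fun _ : ℕ => Fin N),
      μ.map (fun (x : ℕ → Fin N) (k : ℕ) => x (k + 1)) A =
        μ.withDensity (fun x => ENNReal.ofReal
          (1 / ∏' n : ℕ, T n (x n) (x (n + 1)) / T (n + 1) (x n) (x (n + 1)))) A := by
    intro A hA
    have hAm := MeasurableSet.of_mem_measurableCylinders hA
    obtain ⟨I, S, -, rfl⟩ := (mem_measurableCylinders _).1 hA
    rw [withDensity_apply _ hAm]
    refine tendsto_nhds_unique (tendsto_const_nhds.congr' ?_)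
      (tendsto_lintegral_of_dominated_convergence _ hf
        (fun n => Eventually.of_forall (hbound n)) (by simp [ENNReal.mul_eq_top])
        (Eventually.of_forall hlim))
    filter_upwards [eventually_ge_atTop (I.sup id)] with n hn
    have hI : I ⊆ Iic n := fun i hi => mem_Iic.2 ((le_sup (f := id) hi).trans hn)
    exact hμ.map_shift_cylinder_eq_setLIntegral (fun i => (hl i).le) hpos hfix n
      (Finset.restrict₂ (π := fun _ => Fin N) hI ⁻¹' S)
  have hmap := ext_of_generate_finite _ generateFrom_measurableCylinders.symm
    isPiSystem_measurableCylinders hcyl (hcyl _ (univ_mem_measurableCylinders _))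
  rw [hmap]
  exact ⟨withDensity_absolutelyContinuous _ _, Measure.rnDeriv_withDensity _ hlim_meas⟩
end

section
/- Let μ and μ' be two quasi-stationary Markov measures on K_N, associated to (λ, T) and (λ', T') respectively. Define Z_∞ : K_N → [0,∞] by Z_∞(x₁x₂…) = (λ'_{x₁}/λ_{x₁}) · limsup_{n→∞} ∏_{k=1}^{n−1} T'^(k)_{x_k,x_{k+1}} / T^(k)_{x_k,x_{k+1}}. Then μ and μ' are equivalent (mutually absolutely continuous) if and only if μ'({x : Z_∞(x) < ∞}) = 1 and μ({x : Z_∞(x) > 0}) = 1. -/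
open MeasureTheory Filter Finset

/-- `Zinf l l' T T' x = (λ'_{x₁}/λ_{x₁}) · limsup_n ∏_{k=1}^{n-1} T'^(k)_{x_k,x_{k+1}} / T^(k)_{x_k,x_{k+1}}`,
as an extended nonnegative real. -/
noncomputable def Zinf {N : ℕ} (l l' : Fin N → ℝ) (T T' : ℕ → Matrix (Fin N) (Fin N) ℝ)
    (x : ℕ → Fin N) : ENNReal :=
  ENNReal.ofReal (l' (x 0) / l (x 0)) *
    Filter.limsup (fun n => ENNReal.ofReal
      (∏ k ∈ Finset.range n, T' k (x k) (x (k + 1)) / T k (x k) (x (k + 1)))) Filter.atTop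

open scoped Topology

section Density

variable {Ω : Type*} {m : MeasurableSpace Ω}

theorem rnDeriv_ae_eq_div_singleton {β : Type*} [Countable β] [MeasurableSpace β]
    [MeasurableSingletonClass β] {μ ν : Measure β} [IsFiniteMeasure μ] [IsFiniteMeasure ν]
    (h : μ ≪ ν) : μ.rnDeriv ν =ᵐ[ν] fun b => μ {b} / ν {b} := by
  refine ae_iff_of_countable.2 fun b hb => ?_
  rw [ENNReal.eq_div_iff hb (measure_ne_top _ _), mul_comm, ← lintegral_singleton,
    Measure.setLIntegral_rnDeriv h]

/-- Along a filtration generated by countably-valued maps `g n`, the quotients of the measures of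
the fibres through `x` converge almost everywhere to the Radon-Nikodym derivative. -/
theorem tendsto_measure_fiber_div {β : ℕ → Type*} [∀ n, Countable (β n)]
    [∀ n, MeasurableSpace (β n)] [∀ n, MeasurableSingletonClass (β n)]
    {μ ν : Measure Ω} [IsFiniteMeasure μ] [IsFiniteMeasure ν] (h : μ ≪ ν)
    (ℱ : Filtration ℕ m) {g : ∀ n, Ω → β n} (hg : ∀ n, Measurable (g n))
    (hℱ : ∀ n, ℱ n = MeasurableSpace.comap (g n) inferInstance) (hsup : ⨆ n, ℱ n = m) :
    ∀ᵐ x ∂ν, Tendsto (fun n => μ (g n ⁻¹' {g n x}) / ν (g n ⁻¹' {g n x})) atTop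
      (𝓝 (μ.rnDeriv ν x)) := by
  have hmeas : StronglyMeasurable[⨆ n, ℱ n] fun x => (μ.rnDeriv ν x).toReal := by
    rw [hsup]
    exact (Measure.measurable_rnDeriv μ ν).ennreal_toReal.stronglyMeasurable
  have hfib : ∀ᵐ x ∂ν, ∀ n, (ν[fun y => (μ.rnDeriv ν y).toReal | ℱ n]) x =
      (μ (g n ⁻¹' {g n x}) / ν (g n ⁻¹' {g n x})).toReal := by
    refine ae_all_iff.2 fun n => ?_
    rw [hℱ n]
    filter_upwards [toReal_rnDeriv_map h (hg n),
      ae_of_ae_map (hg n).aemeasurable (rnDeriv_ae_eq_div_singleton (h.map (hg n)))]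
      with x hx hx'
    rw [← hx, hx', Measure.map_apply (hg n) (measurableSet_singleton _),
      Measure.map_apply (hg n) (measurableSet_singleton _)]
  have hfin : ∀ᵐ x ∂ν, ∀ n, ν (g n ⁻¹' {g n x}) ≠ 0 := by
    refine ae_all_iff.2 fun n => ae_of_ae_map (p := fun b => ν (g n ⁻¹' {b}) ≠ 0)
      (hg n).aemeasurable ?_
    refine ae_iff_of_countable.2 fun b hb => ?_
    rwa [Measure.map_apply (hg n) (measurableSet_singleton _)] at hb
  filter_upwards [Measure.integrable_toReal_rnDeriv.tendsto_ae_condExp hmeas, hfib, hfin,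
    Measure.rnDeriv_ne_top μ ν] with x hx hx' hx0 hxtop
  simp only [hx'] at hx
  exact (ENNReal.tendsto_toReal_iff
    (fun n => ENNReal.div_ne_top (measure_ne_top _ _) (hx0 n)) hxtop).1 hx

theorem absolutelyContinuous_iff_ae_rnDeriv_ne_zero {μ μ' ν : Measure Ω} [SigmaFinite μ]
    [SigmaFinite ν] (h : μ ≪ ν) (h' : μ' ≪ ν) :
    μ' ≪ μ ↔ ∀ᵐ x ∂μ', μ.rnDeriv ν x ≠ 0 := by
  constructor
  · intro hac
    filter_upwards [hac.ae_le (Measure.rnDeriv_pos h)] with x hx using hx.ne'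
  · intro hne s hs
    rw [← Measure.withDensity_rnDeriv_eq μ ν h,
      withDensity_apply_eq_zero (Measure.measurable_rnDeriv μ ν)] at hs
    exact measure_mono_null_ae (by filter_upwards [hne] with x hx hxs using ⟨hx, hxs⟩) (h' hs)

end Density

theorem iSup_piLE_nat {X : ℕ → Type*} [∀ n, MeasurableSpace (X n)] :
    ⨆ n, (Filtration.piLE (X := X)) n = MeasurableSpace.pi := by
  refine le_antisymm (iSup_le fun n => Filtration.piLE.le n) ?_
  refine iSup_le fun n => le_trans ?_ (le_iSup _ n)
  rw [Filtration.piLE_eq_comap_frestrictLe]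
  rintro _ ⟨s, hs, rfl⟩
  have hn : Measurable fun y : (∀ i : Finset.Iic n, X i) => y ⟨n, Finset.mem_Iic.2 le_rfl⟩ :=
    measurable_pi_apply _
  exact ⟨_, hn hs, rfl⟩

theorem frestrictLe_fiber {X : ℕ → Type*} (n : ℕ) (x : ∀ n, X n) :
    Preorder.frestrictLe n ⁻¹' {Preorder.frestrictLe n x} = {y | ∀ k ≤ n, y k = x k} := by
  ext y
  simp [funext_iff, Preorder.frestrictLe]

section Markov

variable {N : ℕ} {l l' : Fin N → ℝ} {T T' : ℕ → Matrix (Fin N) (Fin N) ℝ}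
  {μ μ' : Measure (ℕ → Fin N)}

theorem Zinf_eq_limsup_cylinder (hl : ∀ i, 0 < l i) (hpos : ∀ n i j, 0 < T n i j)
    (hl' : ∀ i, 0 < l' i) (hμ : IsMarkov μ l T) (hμ' : IsMarkov μ' l' T') (x : ℕ → Fin N) :
    Zinf l l' T T' x =
      limsup (fun n => μ' {y | ∀ k ≤ n, y k = x k} / μ {y | ∀ k ≤ n, y k = x k}) atTop := by
  rw [Zinf, ← ENNReal.limsup_const_mul_of_ne_top ENNReal.ofReal_ne_top]
  congr 1
  ext n
  rw [hμ n x, hμ' n x, ← ENNReal.ofReal_div_of_pos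
    (mul_pos (hl _) (Finset.prod_pos fun k _ => hpos _ _ _)),
    ← ENNReal.ofReal_mul (div_pos (hl' _) (hl _)).le, Finset.prod_div_distrib, div_mul_div_comm]

/-- `Z_∞` is almost everywhere the quotient of the densities of `μ'` and `μ`. -/
theorem Zinf_ae_eq_rnDeriv_div (hl : ∀ i, 0 < l i) (hpos : ∀ n i j, 0 < T n i j)
    (hl' : ∀ i, 0 < l' i) [IsFiniteMeasure μ] [IsFiniteMeasure μ']
    (hμ : IsMarkov μ l T) (hμ' : IsMarkov μ' l' T') :
    ∀ᵐ x ∂(μ + μ'), (μ.rnDeriv (μ + μ') x ≠ 0 ∨ μ'.rnDeriv (μ + μ') x ≠ 0) ∧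
      Zinf l l' T T' x = μ'.rnDeriv (μ + μ') x / μ.rnDeriv (μ + μ') x := by
  have hac : μ ≪ μ + μ' := Measure.AbsolutelyContinuous.rfl.add_right _
  have hac' : μ' ≪ μ + μ' := add_comm μ' μ ▸ Measure.AbsolutelyContinuous.rfl.add_right _
  have hne : ∀ᵐ x ∂(μ + μ'), μ.rnDeriv (μ + μ') x ≠ 0 ∨ μ'.rnDeriv (μ + μ') x ≠ 0 := by
    rw [ae_add_measure_iff]
    have := Measure.haveLebesgueDecomposition_of_sigmaFinite μ (μ + μ')
    have := Measure.haveLebesgueDecomposition_of_sigmaFinite μ' (μ + μ')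
    constructor
    · filter_upwards [Measure.rnDeriv_pos hac] with x hx using .inl hx.ne'
    · filter_upwards [Measure.rnDeriv_pos hac'] with x hx using .inr hx.ne'
  have hcyl {ρ : Measure (ℕ → Fin N)} [IsFiniteMeasure ρ] (h : ρ ≪ μ + μ') :=
    tendsto_measure_fiber_div h Filtration.piLE
      (fun n => Preorder.measurable_frestrictLe (X := fun _ => Fin N) n)
      Filtration.piLE_eq_comap_frestrictLe iSup_piLE_nat
  filter_upwards [hne, hcyl hac, hcyl hac', Measure.rnDeriv_ne_top μ (μ + μ')]
    with x hx0 hx hx' hxtop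
  refine ⟨hx0, ?_⟩
  rw [Zinf_eq_limsup_cylinder hl hpos hl' hμ hμ']
  refine ((ENNReal.Tendsto.div hx' hx0.symm hx (.inl hxtop)).congr fun n => ?_).limsup_eq
  rw [frestrictLe_fiber]
  have hpos0 : μ {y | ∀ k ≤ n, y k = x k} ≠ 0 := by
    rw [hμ n x]
    simpa using mul_pos (hl _) (Finset.prod_pos fun k _ => hpos _ _ _)
  have hposadd : (μ + μ') {y | ∀ k ≤ n, y k = x k} ≠ 0 := fun h0 => hpos0 (hac h0)
  rw [div_eq_mul_inv (μ' _) ((μ + μ') _), div_eq_mul_inv (μ _) ((μ + μ') _),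
    ENNReal.mul_div_mul_right _ _ (ENNReal.inv_ne_zero.2 (measure_ne_top _ _))
      (ENNReal.inv_ne_top.2 hposadd)]

end Markov

/-- Two quasi-stationary Markov measures `μ, μ'` are equivalent if and only if
`μ'(Z_∞ < ∞) = 1` and `μ(Z_∞ > 0) = 1`. -/
theorem markov_equivalent_iff_Zinf (N : ℕ) (hN : 2 ≤ N)
    (l l' : Fin N → ℝ) (T T' : ℕ → Matrix (Fin N) (Fin N) ℝ)
    (hl : ∀ i, 0 < l i) (hlsum : ∑ i, l i = 1)
    (hpos : ∀ n i j, 0 < T n i j) (hstoch : ∀ n i, ∑ j, T n i j = 1)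
    (hfix : ∀ j, ∑ i, l i * T 0 i j = l j)
    (hl' : ∀ i, 0 < l' i) (hlsum' : ∑ i, l' i = 1)
    (hpos' : ∀ n i j, 0 < T' n i j) (hstoch' : ∀ n i, ∑ j, T' n i j = 1)
    (hfix' : ∀ j, ∑ i, l' i * T' 0 i j = l' j)
    (μ μ' : Measure (ℕ → Fin N)) [IsProbabilityMeasure μ] [IsProbabilityMeasure μ']
    (hμ : IsMarkov μ l T) (hμ' : IsMarkov μ' l' T')
    (hqs : ∀ x : ℕ → Fin N,
      Summable fun n => |T n (x n) (x (n + 1)) / T (n + 1) (x n) (x (n + 1)) - 1|)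
    (hqs' : ∀ x : ℕ → Fin N,
      Summable fun n => |T' n (x n) (x (n + 1)) / T' (n + 1) (x n) (x (n + 1)) - 1|)
    :
    (μ ≪ μ' ∧ μ' ≪ μ) ↔
      (μ' {x | Zinf l l' T T' x < ⊤} = 1 ∧ μ {x | 0 < Zinf l l' T T' x} = 1) := by
  have hac : μ ≪ μ + μ' := Measure.AbsolutelyContinuous.rfl.add_right _
  have hac' : μ' ≪ μ + μ' := add_comm μ' μ ▸ Measure.AbsolutelyContinuous.rfl.add_right _
  have hZ := Zinf_ae_eq_rnDeriv_div hl hpos hl' hμ hμ'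
  have hfin : {x | Zinf l l' T T' x < ⊤} =ᵐ[μ'] {x | μ.rnDeriv (μ + μ') x ≠ 0} := by
    filter_upwards [hac'.ae_le hZ, hac'.ae_le (Measure.rnDeriv_ne_top μ' (μ + μ'))]
      with x ⟨hx0, hx⟩ hxtop
    refine propext ?_
    change Zinf l l' T T' x < ⊤ ↔ μ.rnDeriv (μ + μ') x ≠ 0
    rw [hx, lt_top_iff_ne_top, Ne, ENNReal.div_eq_top]
    tauto
  have hzero : {x | 0 < Zinf l l' T T' x} =ᵐ[μ] {x | μ'.rnDeriv (μ + μ') x ≠ 0} := by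
    filter_upwards [hac.ae_le hZ, hac.ae_le (Measure.rnDeriv_ne_top μ (μ + μ'))]
      with x ⟨_, hx⟩ hxtop
    refine propext ?_
    change 0 < Zinf l l' T T' x ↔ μ'.rnDeriv (μ + μ') x ≠ 0
    rw [hx, ENNReal.div_pos_iff]
    exact and_iff_left hxtop
  have hmeas (ρ : Measure (ℕ → Fin N)) :
      MeasurableSet {x | ρ.rnDeriv (μ + μ') x ≠ 0} :=
    (Measure.measurable_rnDeriv ρ (μ + μ')) (measurableSet_singleton 0).compl
  rw [measure_congr hfin, measure_congr hzero, ← mem_ae_iff_prob_eq_one (hmeas μ),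
    ← mem_ae_iff_prob_eq_one (hmeas μ'), and_comm,
    absolutelyContinuous_iff_ae_rnDeriv_ne_zero hac hac',
    absolutelyContinuous_iff_ae_rnDeriv_ne_zero hac' hac]
  rfl
end

section
/- Let μ and μ' be two quasi-stationary Markov measures on K_N, associated to (λ, T) and (λ', T') respectively. Define Z_∞ : K_N → [0,∞] by Z_∞(x₁x₂…) = (λ'_{x₁}/λ_{x₁}) · limsup_{n→∞} ∏_{k=1}^{n−1} T'^(k)_{x_k,x_{k+1}} / T^(k)_{x_k,x_{k+1}}. Then μ and μ' are mutually singular if and only if μ'({x : Z_∞(x) = ∞}) = 1 or μ({x : Z_∞(x) = 0}) = 1. -/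
open MeasureTheory Filter Finset

/-- The cylinder of all words agreeing with `x` in the first `n + 1` letters. -/
def wordCylinder {N : ℕ} (n : ℕ) (x : ℕ → Fin N) : Set (ℕ → Fin N) :=
  {y | ∀ k ≤ n, y k = x k}

lemma mem_wordCylinder_self {N : ℕ} (n : ℕ) (x : ℕ → Fin N) : x ∈ wordCylinder n x :=
  fun _ _ => rfl

lemma wordCylinder_eq_of_mem {N : ℕ} {m n : ℕ} (hmn : m ≤ n) {x y : ℕ → Fin N}
    (h : y ∈ wordCylinder n x) : wordCylinder m y = wordCylinder m x := by
  ext z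
  refine forall₂_congr fun k hk => ?_
  rw [h k (hk.trans hmn)]

lemma exists_wordCylinder_subset {N : ℕ} {U : Set (ℕ → Fin N)} (hU : IsOpen U)
    {x : ℕ → Fin N} (hx : x ∈ U) : ∃ n, ∀ m ≥ n, wordCylinder m x ⊆ U := by
  obtain ⟨I, u, hu, hsub⟩ := isOpen_pi_iff.1 hU x hx
  refine ⟨I.sup id, fun m hm y hy => hsub fun i hi => ?_⟩
  rw [hy i ((Finset.le_sup (f := id) hi).trans hm)]
  exact (hu i hi).2

/-- If a set is a union of cylinders of length `n + 1`, a comparison of two measures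
on the cylinders extends to it. -/
lemma mul_measure_le_of_wordCylinder {N : ℕ} (μ ν : Measure (ℕ → Fin N)) (a : ENNReal) (n : ℕ)
    {E : Set (ℕ → Fin N)} (hE : ∀ x ∈ E, wordCylinder n x ⊆ E)
    (h : ∀ x ∈ E, a * μ (wordCylinder n x) ≤ ν (wordCylinder n x)) :
    MeasurableSet E ∧ a * μ E ≤ ν E := by
  classical
  let r : (ℕ → Fin N) → (Fin (n + 1) → Fin N) := fun x i => x i
  have hr : Measurable r := measurable_pi_lambda _ fun i => measurable_pi_apply _
  let s : Finset (Fin (n + 1) → Fin N) := (r '' E).toFinite.toFinset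
  have hfib : ∀ x, r ⁻¹' {r x} = wordCylinder n x := by
    intro x
    ext y
    constructor
    · intro hy k hk
      exact congrFun hy ⟨k, Nat.lt_succ_of_le hk⟩
    · intro hy
      funext i
      exact hy i (Nat.le_of_lt_succ i.2)
  have hEs : E = r ⁻¹' (s : Set (Fin (n + 1) → Fin N)) := by
    ext y
    simp only [s, Set.Finite.coe_toFinset, Set.mem_preimage, Set.mem_image]
    constructor
    · exact fun hy => ⟨y, hy, rfl⟩
    · rintro ⟨x, hx, hxy⟩
      apply hE x hx
      rw [← hfib]
      exact hxy.symm
  have hm : ∀ v, MeasurableSet (r ⁻¹' {v}) := fun v => hr (measurableSet_singleton v)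
  refine ⟨hEs ▸ hr s.measurableSet, ?_⟩
  rw [hEs, ← sum_measure_preimage_singleton s fun v _ => hm v,
    ← sum_measure_preimage_singleton s fun v _ => hm v, Finset.mul_sum]
  refine Finset.sum_le_sum fun v hv => ?_
  obtain ⟨x, hx, rfl⟩ : v ∈ r '' E := by simpa [s] using hv
  rw [hfib]
  exact h x hx

/-- Covering lemma: if around every point of `B` the inequality `a * μ ≤ ν` holds on arbitrarily
small cylinders, then it holds on `B`. -/
lemma mul_measure_le_of_frequently {N : ℕ} (μ ν : Measure (ℕ → Fin N)) [IsFiniteMeasure ν]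
    (a : ENNReal) (B : Set (ℕ → Fin N))
    (h : ∀ x ∈ B, ∃ᶠ n in atTop, a * μ (wordCylinder n x) ≤ ν (wordCylinder n x)) :
    a * μ B ≤ ν B := by
  classical
  refine ENNReal.le_of_forall_pos_le_add fun ε hε _ => ?_
  obtain ⟨U, hBU, hU, hUε⟩ := B.exists_isOpen_lt_add (measure_ne_top ν B)
    (ENNReal.coe_ne_zero.2 hε.ne')
  let P : ℕ → (ℕ → Fin N) → Prop := fun n x =>
    wordCylinder n x ⊆ U ∧ a * μ (wordCylinder n x) ≤ ν (wordCylinder n x)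
  have hP : ∀ {m n : ℕ} {x y : ℕ → Fin N}, m ≤ n → y ∈ wordCylinder n x → (P m y ↔ P m x) := by
    intro m n x y hmn hy
    simp only [P, wordCylinder_eq_of_mem hmn hy]
  let E : ℕ → Set (ℕ → Fin N) := fun n => {x | P n x ∧ ∀ m < n, ¬ P m x}
  have hE : ∀ n, MeasurableSet (E n) ∧ a * μ (E n) ≤ ν (E n) := fun n =>
    mul_measure_le_of_wordCylinder μ ν a n
      (fun x hx y hy => ⟨(hP le_rfl hy).2 hx.1, fun m hm => fun hy' =>
        hx.2 m hm ((hP hm.le hy).1 hy')⟩)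
      fun x hx => hx.1.2
  have hdisj : Pairwise (Function.onFun Disjoint E) := by
    intro i j hij
    refine Set.disjoint_left.2 fun x hi hj => ?_
    rcases hij.lt_or_gt with hlt | hlt
    · exact hj.2 i hlt hi.1
    · exact hi.2 j hlt hj.1
  have hBE : B ⊆ ⋃ n, E n := by
    intro x hx
    obtain ⟨n₀, hn₀⟩ := exists_wordCylinder_subset hU (hBU hx)
    obtain ⟨n, hn, hle⟩ := (frequently_atTop.1 (h x hx)) n₀
    have hex : ∃ n, P n x := ⟨n, hn₀ n hn, hle⟩
    exact Set.mem_iUnion.2 ⟨Nat.find hex, Nat.find_spec hex, fun m hm => Nat.find_min hex hm⟩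
  have hEU : (⋃ n, E n) ⊆ U :=
    Set.iUnion_subset fun n x hx => hx.1.1 (mem_wordCylinder_self n x)
  calc a * μ B ≤ a * μ (⋃ n, E n) := by gcongr
    _ = ∑' n, a * μ (E n) := by
      rw [measure_iUnion hdisj fun n => (hE n).1, ENNReal.tsum_mul_left]
    _ ≤ ∑' n, ν (E n) := ENNReal.tsum_le_tsum fun n => (hE n).2
    _ = ν (⋃ n, E n) := (measure_iUnion hdisj fun n => (hE n).1).symm
    _ ≤ ν U := measure_mono hEU
    _ ≤ ν B + ε := hUε.le

lemma eq_zero_of_forall_nat_mul_le {m b : ENNReal} (hb : b ≠ ⊤) (h : ∀ a : ℕ, a * m ≤ b) :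
    m = 0 := by
  by_contra hm
  obtain ⟨a, ha⟩ := ENNReal.exists_nat_mul_gt hm hb
  exact (h a).not_gt ha

lemma measurable_Zinf {N : ℕ} (l l' : Fin N → ℝ) (T T' : ℕ → Matrix (Fin N) (Fin N) ℝ) :
    Measurable (Zinf l l' T T') := by
  have h1 : Measurable fun x : ℕ → Fin N => l' (x 0) / l (x 0) :=
    (Measurable.of_discrete (f := fun i => l' i / l i)).comp (measurable_pi_apply 0)
  have h2 : ∀ k, Measurable fun x : ℕ → Fin N =>
      T' k (x k) (x (k + 1)) / T k (x k) (x (k + 1)) := fun k =>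
    (Measurable.of_discrete (f := fun p : Fin N × Fin N => T' k p.1 p.2 / T k p.1 p.2)).comp
      (g := fun p : Fin N × Fin N => T' k p.1 p.2 / T k p.1 p.2)
      (f := fun x : ℕ → Fin N => (x k, x (k + 1)))
      ((measurable_pi_apply k).prodMk (measurable_pi_apply (k + 1)))
  exact h1.ennreal_ofReal.mul (Measurable.limsup fun n =>
    (Finset.measurable_fun_prod _ fun k _ => h2 k).ennreal_ofReal)

lemma Zinf_eq_limsup {N : ℕ} (l l' : Fin N → ℝ) (T T' : ℕ → Matrix (Fin N) (Fin N) ℝ)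
    (hl : ∀ i, 0 < l i) (hl' : ∀ i, 0 < l' i) (x : ℕ → Fin N) :
    Zinf l l' T T' x = limsup (fun n => ENNReal.ofReal (l' (x 0) / l (x 0) *
      ∏ k ∈ Finset.range n, T' k (x k) (x (k + 1)) / T k (x k) (x (k + 1)))) atTop := by
  simp only [ENNReal.ofReal_mul (div_pos (hl' _) (hl _)).le]
  exact (ENNReal.limsup_const_mul_of_ne_top ENNReal.ofReal_ne_top).symm

/-- The partial products defining `Zinf` are the densities on cylinders. -/
lemma IsMarkov.ofReal_mul_wordCylinder {N : ℕ} {μ μ' : Measure (ℕ → Fin N)} {l l' : Fin N → ℝ}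
    {T T' : ℕ → Matrix (Fin N) (Fin N) ℝ} (hμ : IsMarkov μ l T) (hμ' : IsMarkov μ' l' T')
    (hl : ∀ i, 0 < l i) (hl' : ∀ i, 0 < l' i)
    (hpos : ∀ n i j, 0 < T n i j) (hpos' : ∀ n i j, 0 < T' n i j) (n : ℕ) (x : ℕ → Fin N) :
    ENNReal.ofReal (l' (x 0) / l (x 0) *
      ∏ k ∈ Finset.range n, T' k (x k) (x (k + 1)) / T k (x k) (x (k + 1))) *
        μ (wordCylinder n x) = μ' (wordCylinder n x) := by
  have hp : 0 < ∏ k ∈ Finset.range n, T k (x k) (x (k + 1)) :=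
    Finset.prod_pos fun k _ => hpos k _ _
  have hp' : 0 < ∏ k ∈ Finset.range n, T' k (x k) (x (k + 1)) :=
    Finset.prod_pos fun k _ => hpos' k _ _
  have hl0 := hl (x 0)
  have hl0' := hl' (x 0)
  rw [wordCylinder, hμ n x, hμ' n x, Finset.prod_div_distrib,
    ← ENNReal.ofReal_mul (by positivity)]
  congr 1
  field_simp

/-- Two quasi-stationary Markov measures `μ, μ'` are mutually singular if and
only if `μ'(Z_∞ = ∞) = 1` or `μ(Z_∞ = 0) = 1`. -/
theorem markov_singular_iff_Zinf (N : ℕ) (hN : 2 ≤ N)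
    (l l' : Fin N → ℝ) (T T' : ℕ → Matrix (Fin N) (Fin N) ℝ)
    (hl : ∀ i, 0 < l i) (hlsum : ∑ i, l i = 1)
    (hpos : ∀ n i j, 0 < T n i j) (hstoch : ∀ n i, ∑ j, T n i j = 1)
    (hfix : ∀ j, ∑ i, l i * T 0 i j = l j)
    (hl' : ∀ i, 0 < l' i) (hlsum' : ∑ i, l' i = 1)
    (hpos' : ∀ n i j, 0 < T' n i j) (hstoch' : ∀ n i, ∑ j, T' n i j = 1)
    (hfix' : ∀ j, ∑ i, l' i * T' 0 i j = l' j)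
    (μ μ' : Measure (ℕ → Fin N)) [IsProbabilityMeasure μ] [IsProbabilityMeasure μ']
    (hμ : IsMarkov μ l T) (hμ' : IsMarkov μ' l' T')
    (hqs : ∀ x : ℕ → Fin N,
      Summable fun n => |T n (x n) (x (n + 1)) / T (n + 1) (x n) (x (n + 1)) - 1|)
    (hqs' : ∀ x : ℕ → Fin N,
      Summable fun n => |T' n (x n) (x (n + 1)) / T' (n + 1) (x n) (x (n + 1)) - 1|)
    :
    μ ⟂ₘ μ' ↔
      (μ' {x | Zinf l l' T T' x = ⊤} = 1 ∨ μ {x | Zinf l l' T T' x = 0} = 1) := by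
  have hZm := measurable_Zinf l l' T T'
  have hdens := hμ.ofReal_mul_wordCylinder hμ' hl hl' hpos hpos'
  have hZ := Zinf_eq_limsup l l' T T' hl hl'
  have hlarge : ∀ (a : ENNReal) (B : Set (ℕ → Fin N)), (∀ x ∈ B, a < Zinf l l' T T' x) →
      a * μ B ≤ μ' B := by
    intro a B hB
    refine mul_measure_le_of_frequently μ μ' a B fun x hx => ?_
    have hlt := hB x hx
    rw [hZ] at hlt
    refine (frequently_lt_of_lt_limsup (by isBoundedDefault) hlt).mono fun n hn => ?_
    rw [← hdens n x]
    gcongr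
  constructor
  · intro hsing
    right
    obtain ⟨S, hS, hμS, hμ'S⟩ := hsing
    refine (prob_compl_eq_zero_iff (hZm (measurableSet_singleton 0))).1 ?_
    refine measure_mono_null (t := S ∪ ⋃ n : ℕ, Sᶜ ∩ {x | ((n : ENNReal) + 1)⁻¹ < Zinf l l' T T' x})
      ?_ (measure_union_null hμS (measure_iUnion_null fun n => ?_))
    · intro x hx
      by_cases hxS : x ∈ S
      · exact Or.inl hxS
      · obtain ⟨n, hn⟩ := ENNReal.exists_inv_nat_lt (a := Zinf l l' T T' x) hx
        refine Or.inr (Set.mem_iUnion.2 ⟨n, hxS, lt_of_le_of_lt ?_ hn⟩)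
        exact ENNReal.inv_le_inv.2 le_self_add
    · have h0 := hlarge ((n : ENNReal) + 1)⁻¹ (Sᶜ ∩ {x | ((n : ENNReal) + 1)⁻¹ < Zinf l l' T T' x})
        fun x hx => hx.2
      rw [measure_mono_null Set.inter_subset_left hμ'S, nonpos_iff_eq_zero, mul_eq_zero] at h0
      refine h0.resolve_left ?_
      simp
  · rintro (h | h)
    · refine ⟨{x | Zinf l l' T T' x = ⊤}, hZm (measurableSet_singleton ⊤), ?_,
        (prob_compl_eq_zero_iff (hZm (measurableSet_singleton ⊤))).2 h⟩
      refine eq_zero_of_forall_nat_mul_le (measure_ne_top μ' _) fun a => hlarge a _ fun x hx => ?_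
      rw [show Zinf l l' T T' x = ⊤ from hx]
      exact ENNReal.natCast_lt_top a
    · refine Measure.MutuallySingular.symm ⟨{x | Zinf l l' T T' x = 0},
        hZm (measurableSet_singleton 0), ?_,
        (prob_compl_eq_zero_iff (hZm (measurableSet_singleton 0))).2 h⟩
      refine eq_zero_of_forall_nat_mul_le (measure_ne_top μ {x | Zinf l l' T T' x = 0}) fun a =>
        mul_measure_le_of_frequently μ' μ a _ fun x hx => Eventually.frequently ?_
      have hlt : Zinf l l' T T' x < (a : ENNReal)⁻¹ := by
        rw [show Zinf l l' T T' x = 0 from hx]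
        simp
      rw [hZ] at hlt
      filter_upwards [eventually_lt_of_limsup_lt hlt] with n hn
      rw [← hdens n x, ← mul_assoc]
      refine mul_le_of_le_one_left' ?_
      calc _ ≤ (a : ENNReal) * (a : ENNReal)⁻¹ := by gcongr
        _ ≤ 1 := ENNReal.mul_inv_le_one _
end

section
/- Let μ and μ' be two quasi-stationary Markov measures on K_N, associated to (λ, T) and (λ', T') respectively. Then μ and μ' are mutually singular if and only if for μ'-almost every i₁i₂… ∈ K_N, Σ_{n=1}^∞ (1 − Σ_{x∈Z_N} √(T'^(n)_{i_n,x}) √(T^(n)_{i_n,x})) = ∞. -/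
open MeasureTheory Filter Finset

open Preorder

/-- Extend a word indexed by `{0, …, n}` to an infinite word, repeating its last letter. -/
def extendWord {α : Type*} {n : ℕ} (w : Finset.Iic n → α) : ℕ → α :=
  fun k => w ⟨min k n, Finset.mem_Iic.2 (min_le_right k n)⟩

lemma extendWord_frestrictLe {α : Type*} {n k : ℕ} (hk : k ≤ n) (x : ℕ → α) :
    extendWord (frestrictLe (π := fun _ => α) n x) k = x k := by
  simp [extendWord, hk]

lemma frestrictLe_extendWord {α : Type*} {n : ℕ} (w : Finset.Iic n → α) :
    frestrictLe (π := fun _ => α) n (extendWord w) = w := by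
  ext ⟨k, hk⟩
  simp [extendWord, Finset.mem_Iic.1 hk]

lemma frestrictLe_eq_iff_mem_cylinder {α : Type*} {n : ℕ} {x y : ℕ → α} :
    frestrictLe (π := fun _ => α) n y = frestrictLe n x ↔ y ∈ PiNat.cylinder x (n + 1) := by
  simp [funext_iff, PiNat.cylinder]

lemma preimage_frestrictLe_singleton {α : Type*} {n : ℕ} (w : Finset.Iic n → α) :
    frestrictLe (π := fun _ => α) n ⁻¹' {w} = PiNat.cylinder (extendWord w) (n + 1) := by
  ext y
  rw [← frestrictLe_eq_iff_mem_cylinder, frestrictLe_extendWord]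
  rfl

lemma preimage_frestrictLe_frestrictLe {α : Type*} (n : ℕ) (x : ℕ → α) :
    frestrictLe (π := fun _ => α) n ⁻¹' {frestrictLe n x} = PiNat.cylinder x (n + 1) := by
  ext y
  rw [← frestrictLe_eq_iff_mem_cylinder]
  rfl

lemma integral_comp_finite {Ω F : Type*} [MeasurableSpace Ω] [Fintype F] [MeasurableSpace F]
    [MeasurableSingletonClass F] (ν : Measure Ω) [IsFiniteMeasure ν] {Φ : Ω → F}
    (hΦ : Measurable Φ) (g : F → ℝ) :
    ∫ x, g (Φ x) ∂ν = ∑ a, ν.real (Φ ⁻¹' {a}) * g a := by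
  have hg : Integrable g (ν.map Φ) := .of_finite
  rw [← integral_map hΦ.aemeasurable hg.aestronglyMeasurable, integral_fintype hg]
  simp [map_measureReal_apply hΦ (measurableSet_singleton _)]

section Markov

variable {N : ℕ} {ν : Measure (ℕ → Fin N)} {a : Fin N → ℝ}
  {P : ℕ → Matrix (Fin N) (Fin N) ℝ}

lemma IsMarkov.measure_cylinder (hν : IsMarkov ν a P) (n : ℕ) (x : ℕ → Fin N) :
    ν (PiNat.cylinder x (n + 1)) =
      ENNReal.ofReal (a (x 0) * ∏ k ∈ Finset.range n, P k (x k) (x (k + 1))) := by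
  rw [← hν n x]
  simp [PiNat.cylinder, Order.lt_add_one_iff]

lemma IsMarkov.measureReal_cylinder (hν : IsMarkov ν a P) (ha : ∀ i, 0 < a i)
    (hP : ∀ n i j, 0 < P n i j) (n : ℕ) (x : ℕ → Fin N) :
    ν.real (PiNat.cylinder x (n + 1)) =
      a (x 0) * ∏ k ∈ Finset.range n, P k (x k) (x (k + 1)) := by
  rw [Measure.real, hν.measure_cylinder, ENNReal.toReal_ofReal]
  exact mul_nonneg (ha _).le (Finset.prod_nonneg fun _ _ => (hP _ _ _).le)

/-- The Markov property: the letter at position `n + 1` is distributed, given the first `n + 1`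
letters, according to the row of `P n` selected by the letter at position `n`. -/
lemma IsMarkov.integral_succ [IsFiniteMeasure ν] (hν : IsMarkov ν a P) (ha : ∀ i, 0 < a i)
    (hP : ∀ n i j, 0 < P n i j) (n : ℕ) (G : (Finset.Iic n → Fin N) → Fin N → ℝ) :
    ∫ x, G (frestrictLe n x) (x (n + 1)) ∂ν =
      ∫ x, ∑ j, P n (x n) j * G (frestrictLe n x) j ∂ν := by
  have hm : Measurable (frestrictLe (π := fun _ => Fin N) n) := measurable_frestrictLe n
  have h1 := integral_comp_finite ν (hm.prodMk (measurable_pi_apply (n + 1)))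
    (fun p => G p.1 p.2)
  have h2 := integral_comp_finite ν hm (fun w => ∑ j, P n (extendWord w n) j * G w j)
  simp only [extendWord_frestrictLe le_rfl] at h2
  rw [h1, h2, Fintype.sum_prod_type]
  refine Finset.sum_congr rfl fun w _ => ?_
  rw [Finset.mul_sum]
  refine Finset.sum_congr rfl fun j _ => ?_
  rw [← mul_assoc]
  congr 1
  set v : ℕ → Fin N := fun k => if k ≤ n then extendWord w k else j with hv
  have hvk : ∀ k ≤ n, v k = extendWord w k := fun k hk => by simp [hv, hk]
  have hset : (fun x : ℕ → Fin N => (frestrictLe (π := fun _ => Fin N) n x, x (n + 1))) ⁻¹'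
      {(w, j)} = PiNat.cylinder v (n + 1 + 1) := by
    ext y
    have : frestrictLe (π := fun _ => Fin N) n y = w ↔ y ∈ PiNat.cylinder (extendWord w) (n + 1) := by
      rw [← preimage_frestrictLe_singleton]; rfl
    simp only [Set.mem_preimage, Set.mem_singleton_iff, Prod.mk.injEq, this, PiNat.cylinder,
      Set.mem_ofPred_eq]
    constructor
    · rintro ⟨h, hj⟩ k hk
      rcases Nat.lt_succ_iff_lt_or_eq.1 hk with hk | rfl
      · rw [h k hk, hvk k (Nat.lt_succ_iff.1 hk)]
      · simp [hv, hj]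
    · intro h
      refine ⟨fun k hk => ?_, ?_⟩
      · rw [h k (by omega), hvk k (Nat.lt_succ_iff.1 hk)]
      · simp [h (n + 1) (by omega), hv]
  rw [hset, preimage_frestrictLe_singleton, hν.measureReal_cylinder ha hP,
    hν.measureReal_cylinder ha hP, Finset.prod_range_succ, hvk 0 (Nat.zero_le n), hvk n le_rfl,
    ← mul_assoc]
  congr 1
  · congr 1
    refine Finset.prod_congr rfl fun k hk => ?_
    have := Finset.mem_range.1 hk
    rw [hvk k (by omega), hvk (k + 1) (by omega)]
  · simp [hv]

lemma prod_extendWord_frestrictLe (u : ℕ → Fin N → Fin N → ℝ) (n : ℕ) (x : ℕ → Fin N) :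
    ∏ k ∈ Finset.range n, u k (extendWord (frestrictLe (π := fun _ => Fin N) n x) k)
        (extendWord (frestrictLe (π := fun _ => Fin N) n x) (k + 1)) =
      ∏ k ∈ Finset.range n, u k (x k) (x (k + 1)) := by
  refine Finset.prod_congr rfl fun k hk => ?_
  have := Finset.mem_range.1 hk
  rw [extendWord_frestrictLe (by omega), extendWord_frestrictLe (by omega)]

/-- Products along a Markov path of factors of conditional mean one form a
martingale. -/
lemma IsMarkov.martingale_prod [IsFiniteMeasure ν] (hν : IsMarkov ν a P) (ha : ∀ i, 0 < a i)
    (hP : ∀ n i j, 0 < P n i j) (u : ℕ → Fin N → Fin N → ℝ)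
    (hu : ∀ n i, ∑ j, P n i j * u n i j = 1) :
    Martingale (fun n (x : ℕ → Fin N) => ∏ k ∈ Finset.range n, u k (x k) (x (k + 1)))
      (Filtration.piLE (X := fun _ => Fin N)) ν := by
  let g : (n : ℕ) → (Finset.Iic n → Fin N) → ℝ := fun n w =>
    ∏ k ∈ Finset.range n, u k (extendWord w k) (extendWord w (k + 1))
  have hg : ∀ n, (fun x : ℕ → Fin N => ∏ k ∈ Finset.range n, u k (x k) (x (k + 1))) =
      fun x => g n (frestrictLe n x) := fun n => funext fun x =>
    (prod_extendWord_frestrictLe u n x).symm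
  refine martingale_of_setIntegral_eq_succ (fun n => ?_) (fun n => ?_) fun n s hs => ?_
  · rw [hg, Filtration.piLE_eq_comap_frestrictLe]
    exact ((Measurable.of_discrete (f := g n)).comp (comap_measurable _)).stronglyMeasurable
  · rw [hg]
    have h : Integrable (g n) (ν.map (frestrictLe n)) := .of_finite
    exact h.comp_measurable (measurable_frestrictLe n)
  · have hs' := Filtration.piLE.le n _ hs
    rw [Filtration.piLE_eq_comap_frestrictLe] at hs
    obtain ⟨t, -, rfl⟩ := hs
    have key := hν.integral_succ ha hP n fun w j =>
      t.indicator (fun w => g n w * u n (extendWord w n) j) w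
    rw [← integral_indicator hs', ← integral_indicator hs']
    convert key.symm using 1
    · refine integral_congr_ae (.of_forall fun x => ?_)
      by_cases hx : frestrictLe n x ∈ t
      · have e := fun j => mul_left_comm (P n (x n) j) (g n (frestrictLe n x)) (u n (x n) j)
        simp only [Set.indicator, Set.mem_preimage, hx, if_true, extendWord_frestrictLe le_rfl,
          e, ← Finset.mul_sum, hu, mul_one]
        exact (prod_extendWord_frestrictLe u n x).symm
      · simp [Set.indicator, hx]
    · refine integral_congr_ae (.of_forall fun x => ?_)
      by_cases hx : frestrictLe n x ∈ t
      · simp only [Set.indicator, Set.mem_preimage, hx, if_true, extendWord_frestrictLe le_rfl,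
          Finset.prod_range_succ]
        rw [← prod_extendWord_frestrictLe u n x]
      · simp [Set.indicator, hx]

/-- Products along a Markov path of nonnegative factors of conditional mean one are almost surely
bounded. -/
lemma IsMarkov.ae_bddAbove_prod [IsProbabilityMeasure ν] (hν : IsMarkov ν a P)
    (ha : ∀ i, 0 < a i) (hP : ∀ n i j, 0 < P n i j) (u : ℕ → Fin N → Fin N → ℝ)
    (hu0 : ∀ n i j, 0 ≤ u n i j) (hu : ∀ n i, ∑ j, P n i j * u n i j = 1) :
    ∀ᵐ x ∂ν, ∃ K : ℝ, ∀ n, ∏ k ∈ Finset.range n, u k (x k) (x (k + 1)) ≤ K := by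
  have hM := hν.martingale_prod ha hP u hu
  have hbdd : ∀ n, eLpNorm (fun x : ℕ → Fin N => ∏ k ∈ Finset.range n, u k (x k) (x (k + 1)))
      1 ν ≤ (1 : NNReal) := fun n => by
    have hnn : ∀ x : ℕ → Fin N, 0 ≤ ∏ k ∈ Finset.range n, u k (x k) (x (k + 1)) :=
      fun x => Finset.prod_nonneg fun _ _ => hu0 _ _ _
    have h0 := hM.setIntegral_eq (Nat.zero_le n) MeasurableSet.univ
    simp only [Finset.range_zero, Finset.prod_empty, Measure.restrict_univ, integral_const,
      probReal_univ, smul_eq_mul, mul_one] at h0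
    rw [eLpNorm_one_eq_lintegral_enorm]
    simp_rw [Real.enorm_of_nonneg (hnn _)]
    rw [← ofReal_integral_eq_lintegral_ofReal (hM.integrable n) (.of_forall hnn), ← h0]
    simp
  filter_upwards [hM.submartingale.exists_ae_tendsto_of_bdd hbdd] with x ⟨c, hc⟩
  obtain ⟨K, hK⟩ := hc.bddAbove_range
  exact ⟨K, fun n => hK ⟨n, rfl⟩⟩

end Markov

section Singularity

open scoped Topology

variable {N : ℕ} {μ ν : Measure (ℕ → Fin N)}

/-- If `ν` is dominated by `M * μ` on all sufficiently long cylinders around points of `B`,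
then it is so on the trace on `B` of any open set. -/
lemma measure_inter_le_of_isOpen {B U : Set (ℕ → Fin N)} {M : ENNReal} {m : ℕ}
    (hB : ∀ x ∈ B, ∀ n ≥ m,
      ν (PiNat.cylinder x (n + 1)) ≤ M * μ (PiNat.cylinder x (n + 1)))
    (hU : IsOpen U) : ν (U ∩ B) ≤ M * μ U := by
  classical
  have hmono : Monotone fun n => {x | PiNat.cylinder x (m + n + 1) ⊆ U} ∩ B :=
    fun n n' h x hx => ⟨(PiNat.cylinder_anti x (by omega)).trans hx.1, hx.2⟩
  have hcover : U ∩ B ⊆ ⋃ n, {x | PiNat.cylinder x (m + n + 1) ⊆ U} ∩ B := by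
    rintro x ⟨hxU, hxB⟩
    obtain ⟨_, ⟨y, n, rfl⟩, hxy, hyU⟩ :=
      (PiNat.isTopologicalBasis_cylinders fun _ => Fin N).exists_subset_of_mem_open hxU hU
    refine Set.mem_iUnion.2 ⟨n, ?_, hxB⟩
    rw [← PiNat.mem_cylinder_iff_eq.1 hxy] at hyU
    exact (PiNat.cylinder_anti x (by omega)).trans hyU
  refine (measure_mono hcover).trans ?_
  rw [hmono.measure_iUnion]
  refine iSup_le fun n => ?_
  set A := {x | PiNat.cylinder x (m + n + 1) ⊆ U} ∩ B
  let π : (ℕ → Fin N) → (Finset.Iic (m + n) → Fin N) := frestrictLe (m + n)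
  have hπ : Measurable π := measurable_frestrictLe _
  let W : Finset (Finset.Iic (m + n) → Fin N) := Finset.univ.filter fun w => ∃ x ∈ A, π x = w
  calc ν A ≤ ν (⋃ w ∈ W, π ⁻¹' {w}) :=
        measure_mono fun x hx => Set.mem_biUnion (x := π x)
          (Finset.mem_filter.2 ⟨Finset.mem_univ _, x, hx, rfl⟩) rfl
    _ ≤ ∑ w ∈ W, ν (π ⁻¹' {w}) := measure_biUnion_finset_le _ _
    _ ≤ ∑ w ∈ W, M * μ (π ⁻¹' {w}) := by
        refine Finset.sum_le_sum fun w hw => ?_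
        obtain ⟨x, hx, rfl⟩ := (Finset.mem_filter.1 hw).2
        rw [preimage_frestrictLe_frestrictLe]
        exact hB x hx.2 _ (Nat.le_add_right m n)
    _ = M * μ (⋃ w ∈ W, π ⁻¹' {w}) := by
        rw [← Finset.mul_sum, measure_biUnion_finset _ fun w _ => hπ (measurableSet_singleton w)]
        exact fun w _ w' _ h => Disjoint.preimage π (Set.disjoint_singleton.2 h)
    _ ≤ M * μ U := by
        gcongr
        refine Set.iUnion₂_subset fun w hw => ?_
        obtain ⟨x, hx, rfl⟩ := (Finset.mem_filter.1 hw).2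
        rw [preimage_frestrictLe_frestrictLe]
        exact hx.1

/-- For mutually singular measures, the ratio of the masses of cylinders around almost every
point is unbounded. -/
lemma ae_frequently_lt_measure_cylinder [IsFiniteMeasure μ] (h : μ ⟂ₘ ν) :
    ∀ᵐ x ∂ν, ∀ M m : ℕ, ∃ n ≥ m,
      M * μ (PiNat.cylinder x (n + 1)) < ν (PiNat.cylinder x (n + 1)) := by
  obtain ⟨S, -, hμS, hνS⟩ := h
  refine ae_all_iff.2 fun M => ae_all_iff.2 fun m => ?_
  set B : Set (ℕ → Fin N) := {x | ∀ n ≥ m,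
    ν (PiNat.cylinder x (n + 1)) ≤ M * μ (PiNat.cylinder x (n + 1))} with hBdef
  have hSB : ν (S ∩ B) = 0 := by
    have hlim : Tendsto (fun r : ENNReal => M * r) (𝓝[>] 0) (𝓝 0) := by
      have := ENNReal.Tendsto.const_mul (a := (M : ENNReal)) (tendsto_id (α := ENNReal) (x := 𝓝 0))
        (Or.inr (ENNReal.natCast_ne_top M))
      rw [mul_zero] at this
      exact this.mono_left nhdsWithin_le_nhds
    refine le_antisymm (ge_of_tendsto hlim ?_) zero_le
    filter_upwards [self_mem_nhdsWithin] with r hr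
    obtain ⟨U, hSU, hU, hUr⟩ := S.exists_isOpen_lt_of_lt r (hμS ▸ hr : μ S < r)
    calc ν (S ∩ B) ≤ ν (U ∩ B) := measure_mono (Set.inter_subset_inter_left _ hSU)
      _ ≤ M * μ U := measure_inter_le_of_isOpen (fun x hx => hx) hU
      _ ≤ M * r := by gcongr
  have hB : ν B = 0 := measure_mono_null
    (fun x hx => (Classical.em (x ∈ S)).imp (fun h => ⟨h, hx⟩) id) (measure_union_null hSB hνS)
  refine measure_mono_null (fun x hx => ?_) hB
  simpa [hBdef] using hx

end Singularity

lemma summable_one_sub_of_le_prod {ρ : ℕ → ℝ} {δ : ℝ} (hδ : 0 < δ) (h0 : ∀ k, 0 < ρ k)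
    (h1 : ∀ k, ρ k ≤ 1) (h : ∀ n, δ ≤ ∏ k ∈ Finset.range n, ρ k) :
    Summable fun k => 1 - ρ k := by
  refine summable_of_sum_range_le (c := -Real.log δ) (fun k => sub_nonneg.2 (h1 k)) fun n => ?_
  calc ∑ k ∈ Finset.range n, (1 - ρ k) ≤ ∑ k ∈ Finset.range n, -Real.log (ρ k) :=
        Finset.sum_le_sum fun k _ => by linarith [Real.log_le_sub_one_of_pos (h0 k)]
    _ = -Real.log (∏ k ∈ Finset.range n, ρ k) := by
        rw [Real.log_prod fun k _ => (h0 k).ne', Finset.sum_neg_distrib]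
    _ ≤ -Real.log δ := neg_le_neg (Real.log_le_log hδ (h n))

lemma exists_prod_le_of_prod_div_le {p h : ℕ → ℝ} {c K : ℝ} (hc : 0 ≤ c) (hh : ∀ k, 0 ≤ h k)
    (hsum : Summable h) (hK : ∀ n, ∏ k ∈ Finset.range n, p k / (1 + c * h k) ≤ K) :
    ∃ K', ∀ n, ∏ k ∈ Finset.range n, p k ≤ K' := by
  refine ⟨max K 0 * Real.exp (c * ∑' k, h k), fun n => ?_⟩
  have hpos : 0 < ∏ k ∈ Finset.range n, (1 + c * h k) :=
    Finset.prod_pos fun k _ => by have := mul_nonneg hc (hh k); linarith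
  have hle := hK n
  rw [Finset.prod_div_distrib, div_le_iff₀ hpos] at hle
  have hexp : ∏ k ∈ Finset.range n, (1 + c * h k) ≤ Real.exp (c * ∑' k, h k) := by
    refine (Real.prod_one_add_le_exp_sum _ fun k => mul_nonneg hc (hh k)).trans ?_
    rw [Real.exp_le_exp, ← Finset.mul_sum]
    exact mul_le_mul_of_nonneg_left (hsum.sum_le_tsum _ fun k _ => hh k) hc
  exact hle.trans (mul_le_mul (le_max_left _ _) hexp hpos.le (le_max_right _ _))

lemma sum_le_prod_one_add {f : ℕ → ℝ} (hf : ∀ k, 0 ≤ f k) (n : ℕ) :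
    ∑ k ∈ Finset.range n, f k ≤ ∏ k ∈ Finset.range n, (1 + f k) := by
  induction n with
  | zero => simp
  | succ n ih =>
    have h1 : 1 ≤ ∏ k ∈ Finset.range n, (1 + f k) :=
      Finset.one_le_prod fun k _ => by linarith [hf k]
    rw [Finset.sum_range_succ, Finset.prod_range_succ]
    nlinarith [hf n]

lemma exists_le_prod_of_prod_le {s : ℕ → ℝ} (hs : ∀ k, 0 < s k) {K₁ K₂ : ℝ}
    (h₁ : ∀ n, ∏ k ∈ Finset.range n, (1 + (1 - s k) + 2 * (1 - s k) ^ 2) ≤ K₁)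
    (h₂ : ∀ n, ∏ k ∈ Finset.range n, (1 + (1 - s k) ^ 2) ≤ K₂) :
    ∃ δ > 0, ∃ m, ∀ n ≥ m, δ ≤ ∏ k ∈ Finset.range n, s k := by
  have hsum : Summable fun k => (1 - s k) ^ 2 :=
    summable_of_sum_range_le (fun k => sq_nonneg _) fun n =>
      (sum_le_prod_one_add (fun k => sq_nonneg (1 - s k)) n).trans (h₂ n)
  obtain ⟨m, hm⟩ := eventually_atTop.1
    (hsum.tendsto_atTop_zero.eventually_lt_const (show (0 : ℝ) < 1 / 4 by norm_num))
  set p : ℕ → ℝ := fun k => 1 + (1 - s k) + 2 * (1 - s k) ^ 2 with hp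
  have hp0 : ∀ k, 0 < p k := fun k => by
    simp only [hp]; nlinarith [sq_nonneg (1 - s k + 1 / 4)]
  have hsp : ∀ k ≥ m, 1 ≤ s k * p k := fun k hk => by
    have hhalf : 1 / 2 ≤ s k := by
      have := abs_lt_of_sq_lt_sq (show (1 - s k) ^ 2 < (1 / 2) ^ 2 by linarith [hm k hk])
        (by norm_num)
      linarith [(abs_lt.1 this).2]
    have : s k * p k = 1 + (1 - s k) ^ 2 * (2 * s k - 1) := by simp only [hp]; ring
    rw [this]
    nlinarith [mul_nonneg (sq_nonneg (1 - s k)) (show 0 ≤ 2 * s k - 1 by linarith)]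
  have hd : 0 < ∏ k ∈ Finset.range m, s k * p k :=
    Finset.prod_pos fun k _ => mul_pos (hs k) (hp0 k)
  have hK : 0 < K₁ := (Finset.prod_pos fun k _ => hp0 k).trans_le (h₁ 0)
  refine ⟨(∏ k ∈ Finset.range m, s k * p k) / K₁, div_pos hd hK, m, fun n hn => ?_⟩
  rw [div_le_iff₀ hK]
  calc ∏ k ∈ Finset.range m, s k * p k ≤ ∏ k ∈ Finset.range n, s k * p k := by
        rw [← Finset.prod_range_mul_prod_Ico _ hn]
        refine le_mul_of_one_le_right hd.le (Finset.one_le_prod fun k hk => ?_)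
        exact hsp k (Finset.mem_Ico.1 hk).1
    _ = (∏ k ∈ Finset.range n, s k) * ∏ k ∈ Finset.range n, p k := Finset.prod_mul_distrib
    _ ≤ (∏ k ∈ Finset.range n, s k) * K₁ :=
        mul_le_mul_of_nonneg_left (h₁ n) (Finset.prod_nonneg fun k _ => (hs k).le)

section Hellinger

variable {N : ℕ} {T T' : ℕ → Matrix (Fin N) (Fin N) ℝ}

/-- The Hellinger affinity of the rows of `T' n` and `T n` at `i`. -/
noncomputable def rowAffinity (T T' : ℕ → Matrix (Fin N) (Fin N) ℝ) (n : ℕ) (i : Fin N) : ℝ :=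
  ∑ x, Real.sqrt (T' n i x) * Real.sqrt (T n i x)

/-- The square root of the ratio of the entries of `T n` and `T' n`. -/
noncomputable def sqrtRatio (T T' : ℕ → Matrix (Fin N) (Fin N) ℝ) (n : ℕ) (i j : Fin N) : ℝ :=
  Real.sqrt (T n i j) / Real.sqrt (T' n i j)

lemma sqrtRatio_pos (hT : ∀ n i j, 0 < T n i j) (hT' : ∀ n i j, 0 < T' n i j) (n : ℕ)
    (i j : Fin N) : 0 < sqrtRatio T T' n i j :=
  div_pos (Real.sqrt_pos.2 (hT n i j)) (Real.sqrt_pos.2 (hT' n i j))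

lemma mul_sqrtRatio (hT' : ∀ n i j, 0 < T' n i j) (n : ℕ) (i j : Fin N) :
    T' n i j * sqrtRatio T T' n i j = Real.sqrt (T' n i j) * Real.sqrt (T n i j) := by
  have h := Real.sqrt_pos.2 (hT' n i j)
  rw [sqrtRatio]
  nth_rewrite 1 [← Real.mul_self_sqrt (hT' n i j).le]
  field_simp

lemma mul_sqrtRatio_sq (hT : ∀ n i j, 0 < T n i j) (hT' : ∀ n i j, 0 < T' n i j) (n : ℕ)
    (i j : Fin N) : T' n i j * sqrtRatio T T' n i j ^ 2 = T n i j := by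
  rw [sqrtRatio, div_pow, Real.sq_sqrt (hT n i j).le, Real.sq_sqrt (hT' n i j).le,
    mul_div_cancel₀ _ (hT' n i j).ne']

lemma sum_mul_quadratic_sqrtRatio (hT : ∀ n i j, 0 < T n i j) (hT' : ∀ n i j, 0 < T' n i j)
    (hs : ∀ n i, ∑ j, T n i j = 1) (hs' : ∀ n i, ∑ j, T' n i j = 1) (b c : ℝ) (n : ℕ)
    (i : Fin N) :
    ∑ j, T' n i j * (1 + b * (1 - sqrtRatio T T' n i j) + c * (1 - sqrtRatio T T' n i j) ^ 2) =
      1 + (b + 2 * c) * (1 - rowAffinity T T' n i) := by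
  have h : ∀ j, T' n i j *
      (1 + b * (1 - sqrtRatio T T' n i j) + c * (1 - sqrtRatio T T' n i j) ^ 2) =
      (1 + b + c) * T' n i j - (b + 2 * c) * (Real.sqrt (T' n i j) * Real.sqrt (T n i j))
        + c * T n i j := fun j => by
    rw [← mul_sqrtRatio hT' n i j, ← mul_sqrtRatio_sq hT hT' n i j]
    ring
  rw [Finset.sum_congr rfl fun j _ => h j, Finset.sum_add_distrib, Finset.sum_sub_distrib,
    ← Finset.mul_sum, ← Finset.mul_sum, ← Finset.mul_sum, hs, hs', rowAffinity]
  ring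

lemma rowAffinity_pos [NeZero N] (hT : ∀ n i j, 0 < T n i j) (hT' : ∀ n i j, 0 < T' n i j)
    (n : ℕ) (i : Fin N) : 0 < rowAffinity T T' n i :=
  Finset.sum_pos (fun j _ => mul_pos (Real.sqrt_pos.2 (hT' n i j)) (Real.sqrt_pos.2 (hT n i j)))
    Finset.univ_nonempty

lemma rowAffinity_le_one (hT : ∀ n i j, 0 < T n i j) (hT' : ∀ n i j, 0 < T' n i j)
    (hs : ∀ n i, ∑ j, T n i j = 1) (hs' : ∀ n i, ∑ j, T' n i j = 1) (n : ℕ) (i : Fin N) :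
    rowAffinity T T' n i ≤ 1 := by
  have h := sum_mul_quadratic_sqrtRatio hT hT' hs hs' 0 1 n i
  have h1 : ∑ j, T' n i j ≤ ∑ j, T' n i j *
      (1 + 0 * (1 - sqrtRatio T T' n i j) + 1 * (1 - sqrtRatio T T' n i j) ^ 2) :=
    Finset.sum_le_sum fun j _ => by
      nlinarith [mul_nonneg (hT' n i j).le (sq_nonneg (1 - sqrtRatio T T' n i j))]
  rw [h, hs'] at h1
  linarith

lemma prod_eq_prod_mul_prod_sqrtRatio_sq (hT : ∀ n i j, 0 < T n i j)
    (hT' : ∀ n i j, 0 < T' n i j) (n : ℕ) (x : ℕ → Fin N) :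
    ∏ k ∈ Finset.range n, T k (x k) (x (k + 1)) =
      (∏ k ∈ Finset.range n, T' k (x k) (x (k + 1))) *
        (∏ k ∈ Finset.range n, sqrtRatio T T' k (x k) (x (k + 1))) ^ 2 := by
  rw [← Finset.prod_pow, ← Finset.prod_mul_distrib]
  exact Finset.prod_congr rfl fun k _ => (mul_sqrtRatio_sq hT hT' _ _ _).symm

variable {l l' : Fin N → ℝ} {μ μ' : Measure (ℕ → Fin N)} [IsProbabilityMeasure μ']

lemma IsMarkov.ae_exists_prod_quadratic_le (hμ' : IsMarkov μ' l' T') (hl' : ∀ i, 0 < l' i)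
    (hT : ∀ n i j, 0 < T n i j) (hT' : ∀ n i j, 0 < T' n i j)
    (hs : ∀ n i, ∑ j, T n i j = 1) (hs' : ∀ n i, ∑ j, T' n i j = 1) {b c : ℝ}
    (hbc : 0 ≤ b + 2 * c) (hq : ∀ t : ℝ, 0 ≤ 1 + b * t + c * t ^ 2) :
    ∀ᵐ x ∂μ', (Summable fun n => 1 - rowAffinity T T' n (x n)) →
      ∃ K, ∀ n, ∏ k ∈ Finset.range n, (1 + b * (1 - sqrtRatio T T' k (x k) (x (k + 1))) +
        c * (1 - sqrtRatio T T' k (x k) (x (k + 1))) ^ 2) ≤ K := by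
  have hh : ∀ n i, 0 ≤ 1 - rowAffinity T T' n i := fun n i =>
    sub_nonneg.2 (rowAffinity_le_one hT hT' hs hs' n i)
  have hpos : ∀ n i, 0 < 1 + (b + 2 * c) * (1 - rowAffinity T T' n i) := fun n i => by
    have := mul_nonneg hbc (hh n i)
    linarith
  have hae := hμ'.ae_bddAbove_prod hl' hT' (fun n i j =>
    (1 + b * (1 - sqrtRatio T T' n i j) + c * (1 - sqrtRatio T T' n i j) ^ 2) /
      (1 + (b + 2 * c) * (1 - rowAffinity T T' n i)))
    (fun n i j => div_nonneg (hq _) (hpos n i).le) fun n i => by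
      simp_rw [← mul_div_assoc]
      rw [← Finset.sum_div, sum_mul_quadratic_sqrtRatio hT hT' hs hs', div_self (hpos n i).ne']
  filter_upwards [hae] with x ⟨K, hK⟩ hsum
  exact exists_prod_le_of_prod_div_le hbc (fun k => hh k (x k)) hsum hK

/-- Singularity forces almost sure divergence of the Hellinger series. -/
lemma IsMarkov.ae_not_summable [IsProbabilityMeasure μ] (hμ : IsMarkov μ l T)
    (hμ' : IsMarkov μ' l' T') (hl : ∀ i, 0 < l i) (hl' : ∀ i, 0 < l' i)
    (hT : ∀ n i j, 0 < T n i j) (hT' : ∀ n i j, 0 < T' n i j)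
    (hs : ∀ n i, ∑ j, T n i j = 1) (hs' : ∀ n i, ∑ j, T' n i j = 1) (hsing : μ ⟂ₘ μ') :
    ∀ᵐ x ∂μ', ¬ Summable fun n => 1 - rowAffinity T T' n (x n) := by
  filter_upwards [ae_frequently_lt_measure_cylinder hsing,
    hμ'.ae_exists_prod_quadratic_le hl' hT hT' hs hs' (b := 1) (c := 2) (by norm_num)
      fun t => by nlinarith [sq_nonneg (t + 1 / 4)],
    hμ'.ae_exists_prod_quadratic_le hl' hT hT' hs hs' (b := 0) (c := 1) (by norm_num)
      fun t => by nlinarith [sq_nonneg t]] with x hx h₁ h₂ hsum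
  obtain ⟨K₁, hK₁⟩ := h₁ hsum
  obtain ⟨K₂, hK₂⟩ := h₂ hsum
  simp only [one_mul, zero_mul, add_zero] at hK₁ hK₂
  obtain ⟨δ, hδ, m, hm⟩ := exists_le_prod_of_prod_le
    (s := fun k => sqrtRatio T T' k (x k) (x (k + 1))) (fun k => sqrtRatio_pos hT hT' _ _ _)
    hK₁ hK₂
  obtain ⟨M, hM⟩ := exists_nat_ge (l' (x 0) / (l (x 0) * δ ^ 2))
  obtain ⟨n, hn, hlt⟩ := hx M m
  refine hlt.not_ge ?_
  rw [hμ.measure_cylinder, hμ'.measure_cylinder, ← ENNReal.ofReal_natCast,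
    ← ENNReal.ofReal_mul (Nat.cast_nonneg M), prod_eq_prod_mul_prod_sqrtRatio_sq hT hT']
  refine ENNReal.ofReal_le_ofReal ?_
  have hle := pow_le_pow_left₀ hδ.le (hm n hn) 2
  rw [div_le_iff₀ (mul_pos (hl _) (pow_pos hδ 2))] at hM
  have hP : 0 ≤ ∏ k ∈ Finset.range n, T' k (x k) (x (k + 1)) :=
    Finset.prod_nonneg fun k _ => (hT' _ _ _).le
  calc l' (x 0) * ∏ k ∈ Finset.range n, T' k (x k) (x (k + 1))
      ≤ M * (l (x 0) * (∏ k ∈ Finset.range n, sqrtRatio T T' k (x k) (x (k + 1))) ^ 2) *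
          ∏ k ∈ Finset.range n, T' k (x k) (x (k + 1)) := by
        refine mul_le_mul_of_nonneg_right (hM.trans ?_) hP
        have := (hl (x 0)).le
        gcongr
    _ = _ := by ring

/-- Almost sure divergence of the Hellinger series forces singularity. -/
lemma IsMarkov.mutuallySingular [NeZero N] [IsProbabilityMeasure μ] (hμ : IsMarkov μ l T)
    (hμ' : IsMarkov μ' l' T') (hl : ∀ i, 0 < l i) (hl' : ∀ i, 0 < l' i)
    (hT : ∀ n i j, 0 < T n i j) (hT' : ∀ n i j, 0 < T' n i j)
    (hs : ∀ n i, ∑ j, T n i j = 1) (hs' : ∀ n i, ∑ j, T' n i j = 1)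
    (h : ∀ᵐ x ∂μ', ¬ Summable fun n => 1 - rowAffinity T T' n (x n)) : μ ⟂ₘ μ' := by
  have hρ := rowAffinity_pos hT hT'
  have h₁ := hμ.ae_bddAbove_prod hl hT (fun n i j => T' n i j / T n i j)
    (fun n i j => (div_pos (hT' n i j) (hT n i j)).le) fun n i => by
      rw [← hs' n i]
      exact Finset.sum_congr rfl fun j _ => mul_div_cancel₀ _ (hT n i j).ne'
  have h₂ := hμ'.ae_bddAbove_prod hl' hT'
    (fun n i j => sqrtRatio T T' n i j / rowAffinity T T' n i)
    (fun n i j => (div_pos (sqrtRatio_pos hT hT' n i j) (hρ n i)).le) fun n i => by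
      simp_rw [← mul_div_assoc, mul_sqrtRatio hT']
      rw [← Finset.sum_div]
      exact div_self (hρ n i).ne'
  refine Measure.MutuallySingular.mk h₁ (h.and h₂) fun x _ => ?_
  by_contra hx
  simp only [Set.mem_union, Set.mem_compl_iff, not_or, not_not] at hx
  obtain ⟨⟨K₁, hK₁⟩, hns, K₂, hK₂⟩ := hx
  refine hns ?_
  have hS : ∀ n, 0 < ∏ k ∈ Finset.range n, sqrtRatio T T' k (x k) (x (k + 1)) := fun n =>
    Finset.prod_pos fun k _ => sqrtRatio_pos hT hT' _ _ _
  have hK₁0 : 0 < K₁ := one_pos.trans_le (by simpa using hK₁ 0)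
  have hK₂0 : 0 < K₂ := one_pos.trans_le (by simpa using hK₂ 0)
  refine summable_one_sub_of_le_prod (δ := Real.sqrt (1 / K₁) / K₂)
    (div_pos (Real.sqrt_pos.2 (by positivity)) hK₂0) (fun k => hρ k (x k))
    (fun k => rowAffinity_le_one hT hT' hs hs' k (x k)) fun n => ?_
  have hR : 0 < ∏ k ∈ Finset.range n, rowAffinity T T' k (x k) :=
    Finset.prod_pos fun k _ => hρ _ _
  have hP : 0 < ∏ k ∈ Finset.range n, T' k (x k) (x (k + 1)) :=
    Finset.prod_pos fun k _ => hT' _ _ _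
  have e₁ := hK₁ n
  have e₂ := hK₂ n
  rw [Finset.prod_div_distrib, prod_eq_prod_mul_prod_sqrtRatio_sq hT hT',
    div_le_iff₀ (mul_pos hP (pow_pos (hS n) 2))] at e₁
  rw [Finset.prod_div_distrib, div_le_iff₀ hR] at e₂
  have e₃ : 1 / K₁ ≤ (∏ k ∈ Finset.range n, sqrtRatio T T' k (x k) (x (k + 1))) ^ 2 := by
    rw [div_le_iff₀' hK₁0]
    refine le_of_mul_le_mul_left ?_ hP
    linarith
  rw [div_le_iff₀' hK₂0]
  exact (Real.sqrt_le_iff.2 ⟨(hS n).le, e₃⟩).trans e₂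

end Hellinger

/-- Two quasi-stationary Markov measures `μ, μ'` are mutually singular if and
only if for `μ'`-a.e. word `i₁i₂…`,
`Σ_{n=1}^∞ (1 − Σ_{x ∈ Z_N} √(T'^(n)_{i_n,x}) √(T^(n)_{i_n,x})) = ∞`
(the terms are nonnegative, so divergence to `∞` is non-summability). -/
theorem markov_singular_iff_hellinger (N : ℕ) (hN : 2 ≤ N)
    (l l' : Fin N → ℝ) (T T' : ℕ → Matrix (Fin N) (Fin N) ℝ)
    (hl : ∀ i, 0 < l i) (hlsum : ∑ i, l i = 1)
    (hpos : ∀ n i j, 0 < T n i j) (hstoch : ∀ n i, ∑ j, T n i j = 1)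
    (hfix : ∀ j, ∑ i, l i * T 0 i j = l j)
    (hl' : ∀ i, 0 < l' i) (hlsum' : ∑ i, l' i = 1)
    (hpos' : ∀ n i j, 0 < T' n i j) (hstoch' : ∀ n i, ∑ j, T' n i j = 1)
    (hfix' : ∀ j, ∑ i, l' i * T' 0 i j = l' j)
    (μ μ' : Measure (ℕ → Fin N)) [IsProbabilityMeasure μ] [IsProbabilityMeasure μ']
    (hμ : IsMarkov μ l T) (hμ' : IsMarkov μ' l' T')
    (hqs : ∀ x : ℕ → Fin N,
      Summable fun n => |T n (x n) (x (n + 1)) / T (n + 1) (x n) (x (n + 1)) - 1|)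
    (hqs' : ∀ x : ℕ → Fin N,
      Summable fun n => |T' n (x n) (x (n + 1)) / T' (n + 1) (x n) (x (n + 1)) - 1|)
    :
    μ ⟂ₘ μ' ↔
      (∀ᵐ i ∂μ', ¬ Summable fun n =>
        1 - ∑ x : Fin N, Real.sqrt (T' n (i n) x) * Real.sqrt (T n (i n) x)) := by
  have : NeZero N := ⟨by omega⟩
  exact ⟨hμ.ae_not_summable hμ' hl hl' hpos hpos' hstoch hstoch',
    hμ.mutuallySingular hμ' hl hl' hpos hpos' hstoch hstoch'⟩
end
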